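/- arXiv:2312.11429 — 5 statements merged into one kernel-verified Lean document; each statement's English description precedes it below -/
import Mathlib

section
/- Let y ∈ ℝ be fixed and let A ∈ ℝ^{1×N} be random with i.i.d. entries following an exponential distribution with parameter 1. Then for every t > 0: if t < |y|, lim_{N→∞} ℙ(stsp(y,A) < t) = 1 − e^{−2t}, and if t ≥ |y|, lim_{N→∞} ℙ(stsp(y,A) < t) = 1. Equivalently, lim_{N→∞} ℙ(1/t < C_UL(y,A)) equals 1 − e^{−2t} for t < |y| and equals 1 for t ≥ |y|. -/
open MeasureTheory ProbabilityTheory Filter Real Set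
open scoped ENNReal NNReal

noncomputable section

/-- The LASSO objective function `‖Ax - y‖₂² + λ‖x‖₁`. -/
def lassoObj {m N : ℕ} (lam : ℝ) (y : Fin m → ℝ) (A : Matrix (Fin m) (Fin N) ℝ)
    (x : Fin N → ℝ) : ℝ :=
  (∑ i, (A.mulVec x i - y i) ^ 2) + lam * ∑ j, |x j|

/-- The LASSO solution set `Sol(y,A)`. -/
def Sol {m N : ℕ} (lam : ℝ) (y : Fin m → ℝ) (A : Matrix (Fin m) (Fin N) ℝ) :
    Set (Fin N → ℝ) :=
  {x | ∀ z, lassoObj lam y A x ≤ lassoObj lam y A z}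

/-- Support of a vector. -/
def supp {N : ℕ} (x : Fin N → ℝ) : Set (Fin N) := {i | x i ≠ 0}

/-- Stability support: distance to support change. -/
def stsp {m N : ℕ} (lam : ℝ) (y : Fin m → ℝ) (A : Matrix (Fin m) (Fin N) ℝ) : ℝ :=
  sInf {δ : ℝ | 0 ≤ δ ∧ ∃ (y' : Fin m → ℝ) (A' : Matrix (Fin m) (Fin N) ℝ)
    (x x' : Fin N → ℝ), x ∈ Sol lam y A ∧ x' ∈ Sol lam y' A' ∧
    (∀ i, |y' i - y i| ≤ δ) ∧ (∀ i j, |A' i j - A i j| ≤ δ) ∧ supp x ≠ supp x'}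

/-- The LASSO condition number `C_UL(y,A)`; it is `∞` when `stsp(y,A) = 0`. -/
def condUL {m N : ℕ} (lam : ℝ) (y : Fin m → ℝ) (A : Matrix (Fin m) (Fin N) ℝ) : ℝ≥0∞ :=
  if stsp lam y A = 0 then ⊤ else ENNReal.ofReal (1 / stsp lam y A)

/-- `m = 1` case: identify `ℝ^{1×N}` with `ℝ^N` and `ℝ^1` with `ℝ`. -/
def Sol1 {N : ℕ} (lam : ℝ) (y : ℝ) (A : Fin N → ℝ) : Set (Fin N → ℝ) :=
  Sol lam (fun _ : Fin 1 => y) (Matrix.of fun _ j => A j)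

def stsp1 {N : ℕ} (lam : ℝ) (y : ℝ) (A : Fin N → ℝ) : ℝ :=
  stsp lam (fun _ : Fin 1 => y) (Matrix.of fun _ j => A j)

section Deterministic

variable {N : ℕ} {lam y : ℝ} {a : Fin N → ℝ}

lemma mem_Sol1_iff {x : Fin N → ℝ} : x ∈ Sol1 lam y a ↔ ∀ z : Fin N → ℝ,
    (∑ j, a j * x j - y) ^ 2 + lam * ∑ j, |x j| ≤
      (∑ j, a j * z j - y) ^ 2 + lam * ∑ j, |z j| := by
  simp [Sol1, Sol, lassoObj, Matrix.mulVec, dotProduct]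

lemma Sol_eq_Sol1 (y : Fin 1 → ℝ) (A : Matrix (Fin 1) (Fin N) ℝ) :
    Sol lam y A = Sol1 lam (y 0) (A 0) := by
  have hy : y = fun _ => y 0 := by ext i; rw [Subsingleton.elim i 0]
  have hA : A = Matrix.of fun _ j => A 0 j := by ext i j; rw [Subsingleton.elim i 0]; rfl
  conv_lhs => rw [hy, hA]
  rfl

lemma stsp1_le {y' δ : ℝ} {a' x x' : Fin N → ℝ} (hx : x ∈ Sol1 lam y a)
    (hx' : x' ∈ Sol1 lam y' a') (hy : |y' - y| ≤ δ) (ha : ∀ j, |a' j - a j| ≤ δ)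
    (hne : supp x ≠ supp x') : stsp1 lam y a ≤ δ :=
  csInf_le ⟨0, fun _ h => h.1⟩ ⟨(abs_nonneg _).trans hy, fun _ => y', Matrix.of fun _ j => a' j,
    x, x', hx, hx', fun _ => hy, fun _ j => ha j, hne⟩

lemma le_stsp1 {t y₀ : ℝ} {a₀ x₀ x₀' : Fin N → ℝ} (hx₀ : x₀ ∈ Sol1 lam y a)
    (hx₀' : x₀' ∈ Sol1 lam y₀ a₀) (hne : supp x₀ ≠ supp x₀')
    (h : ∀ δ, 0 ≤ δ → δ < t → ∀ (y' : ℝ) (a' x x' : Fin N → ℝ), x ∈ Sol1 lam y a →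
      x' ∈ Sol1 lam y' a' → |y' - y| ≤ δ → (∀ j, |a' j - a j| ≤ δ) → supp x = supp x') :
    t ≤ stsp1 lam y a := by
  refine le_csInf ⟨|y₀ - y| + ∑ j, |a₀ j - a j|, by positivity, fun _ => y₀,
    Matrix.of fun _ j => a₀ j, x₀, x₀', hx₀, hx₀', fun _ => ?_, fun _ j => ?_, hne⟩ ?_
  · exact le_add_of_nonneg_right (by positivity)
  · exact (Finset.single_le_sum (f := fun j => |a₀ j - a j|) (fun _ _ => abs_nonneg _)
      (Finset.mem_univ j)).trans (le_add_of_nonneg_left (abs_nonneg _))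
  · rintro δ ⟨hδ, y', A', x, x', hx, hx', hy, hA, hs⟩
    by_contra! hlt
    rw [Sol_eq_Sol1] at hx'
    exact hs (h δ hδ hlt _ _ x x' hx hx' (hy 0) (hA 0))

lemma zero_mem_Sol1 (h : ∀ k, 2 * |y| * |a k| ≤ lam) : 0 ∈ Sol1 lam y a := by
  rw [mem_Sol1_iff]
  intro z
  have h1 : 2 * (y * ∑ j, a j * z j) ≤ lam * ∑ j, |z j| := by
    rw [Finset.mul_sum, Finset.mul_sum, Finset.mul_sum]
    refine Finset.sum_le_sum fun j _ => ?_
    calc 2 * (y * (a j * z j)) ≤ |2 * (y * (a j * z j))| := le_abs_self _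
      _ = 2 * |y| * |a j| * |z j| := by simp [abs_mul, mul_assoc]
      _ ≤ lam * |z j| := by gcongr; exact h j
  simp only [Pi.zero_apply, mul_zero, Finset.sum_const_zero, abs_zero]
  nlinarith [sq_nonneg (∑ j, a j * z j)]

lemma ne_zero_of_mem_Sol1 (hlam : 0 < lam) {k : Fin N} (h : lam < 2 * |y| * |a k|)
    {x : Fin N → ℝ} (hx : x ∈ Sol1 lam y a) : x ≠ 0 := by
  rintro rfl
  rw [mem_Sol1_iff] at hx
  have hp : 0 < a k ^ 2 := by
    have : a k ≠ 0 := by rintro h0; rw [h0] at h; simp at h; linarith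
    positivity
  obtain ⟨s, hs, hsy⟩ : ∃ s : ℝ, |s| = 1 ∧ s * (a k * y) = |y| * |a k| := by
    rcases le_total 0 (a k * y) with h0 | h0
    · exact ⟨1, by simp, by rw [one_mul, ← abs_mul, mul_comm y, abs_of_nonneg h0]⟩
    · exact ⟨-1, by simp, by rw [neg_one_mul, ← abs_mul, mul_comm y, abs_of_nonpos h0]⟩
  have hs2 : s ^ 2 = 1 := by rw [← sq_abs, hs, one_pow]
  set r := (2 * |y| * |a k| - lam) / (2 * a k ^ 2) with hr
  have hr0 : 0 < r := by apply div_pos <;> linarith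
  have hra : r * (2 * a k ^ 2) = 2 * |y| * |a k| - lam := div_mul_cancel₀ _ (by positivity)
  have h1 := hx (Pi.single k (s * r))
  have h2 : ∑ j, |(Pi.single k (s * r) : Fin N → ℝ) j| = r := by
    rw [Finset.sum_eq_single k (fun j _ hj => by simp [hj]) (by simp)]
    simp [abs_mul, hs, abs_of_pos hr0]
  rw [h2] at h1
  simp [Pi.single_apply] at h1
  have h3 : (a k * (s * r) - y) ^ 2 + lam * r - y ^ 2 = - (a k ^ 2 * r ^ 2) := by
    linear_combination (-2 * r) * hsy + (a k ^ 2 * r ^ 2) * hs2 + r * hra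
  have : 0 < a k ^ 2 * r ^ 2 := by positivity
  linarith

lemma eq_zero_of_mem_Sol1 (hlam : 0 < lam) {i j : Fin N} (h : |a j| < |a i|)
    {x : Fin N → ℝ} (hx : x ∈ Sol1 lam y a) : x j = 0 := by
  by_contra hxj
  have hij : i ≠ j := by rintro rfl; exact lt_irrefl _ h
  have hai : 0 < |a i| := (abs_nonneg _).trans_lt h
  have hai' : a i ≠ 0 := abs_pos.1 hai
  set c := a j * x j / a i with hc
  have hcx : |c| < |x j| := by
    rw [hc, abs_div, abs_mul, div_lt_iff₀ hai, mul_comm]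
    exact mul_lt_mul_of_pos_left h (abs_pos.2 hxj)
  have h1 := mem_Sol1_iff.1 hx (x + Pi.single i c - Pi.single j (x j))
  have h2 : ∑ k, a k * (x + Pi.single i c - Pi.single j (x j) : Fin N → ℝ) k
      = ∑ k, a k * x k := by
    simp only [Pi.add_apply, Pi.sub_apply, mul_add, mul_sub, Finset.sum_add_distrib,
      Finset.sum_sub_distrib, Pi.single_apply, mul_ite, mul_zero, Finset.sum_ite_eq',
      Finset.mem_univ, if_true]
    rw [hc, mul_div_cancel₀ _ hai']
    ring
  have h3 : ∑ k, |(x + Pi.single i c - Pi.single j (x j) : Fin N → ℝ) k|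
      ≤ ∑ k, |x k| + |c| - |x j| := by
    have : ∑ k, |x k| + |c| - |x j| = ∑ k, (|x k| + (Pi.single i |c| : Fin N → ℝ) k
        - (Pi.single j |x j| : Fin N → ℝ) k) := by
      simp [Finset.sum_add_distrib, Finset.sum_sub_distrib]
    rw [this]
    refine Finset.sum_le_sum fun k _ => ?_
    by_cases hk : k = j
    · subst hk
      simp [hij.symm]
    · by_cases hk' : k = i
      · subst hk'
        simpa [hk] using abs_add_le (x k) c
      · simp [hk, hk']
  rw [h2] at h1
  have := mul_le_mul_of_nonneg_left h3 hlam.le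
  nlinarith

lemma Sol1_nonempty (hlam : 0 < lam) (y : ℝ) (a : Fin N → ℝ) : (Sol1 lam y a).Nonempty := by
  have hlim : Tendsto (fun x : Fin N → ℝ => (∑ j, a j * x j - y) ^ 2 + lam * ∑ j, |x j|)
      (cocompact _) atTop := by
    refine tendsto_atTop_mono (fun x => ?_)
      ((tendsto_norm_cocompact_atTop (E := Fin N → ℝ)).const_mul_atTop hlam)
    have : ‖x‖ ≤ ∑ j, |x j| := by
      refine (pi_norm_le_iff_of_nonneg (by positivity)).2 fun j => ?_
      exact Finset.single_le_sum (f := fun j => |x j|) (fun _ _ => abs_nonneg _)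
        (Finset.mem_univ j)
    have := mul_le_mul_of_nonneg_left this hlam.le
    nlinarith [sq_nonneg (∑ j, a j * x j - y)]
  obtain ⟨x, hx⟩ := Continuous.exists_forall_le (by fun_prop) hlim
  exact ⟨x, mem_Sol1_iff.2 hx⟩

lemma exists_mem_Sol1_apply_ne_zero (hlam : 0 < lam) {i : Fin N} (hi : ∀ j, |a j| ≤ |a i|)
    (h : lam < 2 * |y| * |a i|) : ∃ x ∈ Sol1 lam y a, x i ≠ 0 := by
  obtain ⟨x, hx⟩ := Sol1_nonempty hlam y a
  have hai' : a i ≠ 0 := by rintro h0; rw [h0] at h; simp at h; linarith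
  have hai : 0 < |a i| := abs_pos.2 hai'
  set c := (∑ j, a j * x j) / a i with hc
  have hz : Pi.single i c ∈ Sol1 lam y a := by
    rw [mem_Sol1_iff] at hx ⊢
    intro z
    refine le_trans ?_ (hx z)
    have h1 : ∑ j, |(Pi.single i c : Fin N → ℝ) j| = |c| := by
      rw [Finset.sum_eq_single i (fun j _ hj => by simp [hj]) (by simp)]
      simp
    have h2 : ∑ j, a j * (Pi.single i c : Fin N → ℝ) j = ∑ j, a j * x j := by
      simp [Pi.single_apply, hc, mul_div_cancel₀ _ hai']
    have h3 : |c| ≤ ∑ j, |x j| := by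
      rw [hc, abs_div, div_le_iff₀ hai, Finset.sum_mul]
      refine (Finset.abs_sum_le_sum_abs _ _).trans (Finset.sum_le_sum fun j _ => ?_)
      rw [abs_mul, mul_comm]
      exact mul_le_mul_of_nonneg_left (hi j) (abs_nonneg _)
    rw [h1, h2]
    gcongr
  refine ⟨_, hz, fun h0 => ne_zero_of_mem_Sol1 hlam h hz ?_⟩
  rw [Pi.single_eq_same] at h0
  rw [h0, Pi.single_zero]

lemma supp_eq_singleton (hlam : 0 < lam) {i : Fin N} (hi : ∀ j, j ≠ i → |a j| < |a i|)
    (h : lam < 2 * |y| * |a i|) {x : Fin N → ℝ} (hx : x ∈ Sol1 lam y a) : supp x = {i} := by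
  have h0 : ∀ j, j ≠ i → x j = 0 := fun j hj => eq_zero_of_mem_Sol1 hlam (hi j hj) hx
  ext j
  simp only [supp, Set.mem_ofPred_eq, Set.mem_singleton_iff]
  refine ⟨fun hj => by_contra fun hji => hj (h0 j hji), ?_⟩
  rintro rfl hj
  refine ne_zero_of_mem_Sol1 hlam h hx (funext fun k => ?_)
  by_cases hk : k = j
  · rw [hk, hj]; rfl
  · exact h0 k hk

lemma supp_ne_supp_zero {x : Fin N → ℝ} (hx : x ≠ 0) : supp x ≠ supp (0 : Fin N → ℝ) := by
  intro h
  refine hx (funext fun j => ?_)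
  have : j ∉ supp x := by rw [h]; simp [supp]
  simpa [supp] using this

/-- If the largest entry exceeds all others by at least `2 * t`, the support is `t`-stable. -/
lemma le_stsp1_of_gap (hlam : 0 < lam) {t : ℝ} (ht : 0 < t) (hty : t < |y|) {i : Fin N}
    (hi : ∀ j, j ≠ i → |a j| + 2 * t ≤ a i) (hta : t < a i)
    (h : lam ≤ 2 * (|y| - t) * (a i - t)) : t ≤ stsp1 lam y a := by
  have key : ∀ δ, 0 ≤ δ → δ < t → ∀ (y' : ℝ) (a' x' : Fin N → ℝ),
      x' ∈ Sol1 lam y' a' → |y' - y| ≤ δ → (∀ j, |a' j - a j| ≤ δ) → supp x' = {i} := by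
    intro δ hδ hδt y' a' x' hx' hy' ha'
    have hai : a i - δ ≤ |a' i| := by
      have := abs_le.1 (ha' i)
      exact le_trans (by linarith) (le_abs_self _)
    have hyy : |y| - δ ≤ |y'| := by
      have := abs_sub_abs_le_abs_sub y y'
      rw [abs_sub_comm] at this
      linarith
    refine supp_eq_singleton hlam (fun j hj => ?_) ?_ hx'
    · have := hi j hj
      have := abs_sub_abs_le_abs_sub (a' j) (a j)
      have := ha' j
      linarith
    · calc lam ≤ 2 * (|y| - t) * (a i - t) := h
        _ < 2 * (|y| - δ) * (a i - δ) := by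
          apply mul_lt_mul'' <;> nlinarith
        _ ≤ 2 * |y'| * |a' i| := by
          apply mul_le_mul <;> nlinarith [abs_nonneg y']
  obtain ⟨x, hx⟩ := Sol1_nonempty hlam y a
  have hsx : ∀ x ∈ Sol1 lam y a, supp x = {i} := fun x hx =>
    key 0 le_rfl ht y a x hx (by simp) (by simp)
  have hx0 : x ≠ 0 := by
    rintro rfl
    have := hsx 0 hx
    simp [supp, Set.ext_iff] at this
  refine le_stsp1 (y₀ := 0) (a₀ := a) (x₀' := 0) hx (zero_mem_Sol1 (by simp [hlam.le]))
    (supp_ne_supp_zero hx0) ?_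
  intro δ hδ hδt y' a' x x' hx hx' hy' ha'
  rw [hsx x hx, key δ hδ hδt y' a' x' hx' hy' ha']

/-- If two entries lie within `2 * t` of each other at the top, a perturbation smaller than `t`
exchanges them. -/
lemma stsp1_lt_of_close (hlam : 0 < lam) {t : ℝ} {i j : Fin N} (hij : j ≠ i)
    (hi : ∀ k, |a k| ≤ a i) (hj : a i < |a j| + 2 * t) (hj0 : 0 ≤ a j)
    (h : lam < 2 * |y| * |a i|) : stsp1 lam y a < t := by
  have hai0 : 0 ≤ a i := (abs_nonneg _).trans (hi i)
  have hai : 0 < a i := by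
    refine lt_of_le_of_ne hai0 fun h0 => ?_
    rw [← h0] at h; simp at h; linarith
  have hji := hi j
  rw [abs_of_nonneg hj0] at hj hji
  set δ := ((a i - a j) / 2 + t) / 2 with hδ
  have hδt : δ < t := by rw [hδ]; linarith
  have hδ0 : 0 ≤ δ := by rw [hδ]; linarith
  obtain ⟨x, hx, hxi⟩ := exists_mem_Sol1_apply_ne_zero hlam
    (fun k => (hi k).trans (le_abs_self _)) h
  set a' : Fin N → ℝ := a + Pi.single j δ - Pi.single i δ with ha'
  obtain ⟨x', hx'⟩ := Sol1_nonempty hlam y a'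
  have hlt : |a' i| < |a' j| := by
    have e1 : a' i = a i - δ := by simp [ha', hij.symm]
    have e2 : a' j = a j + δ := by simp [ha', hij]
    rw [e1, e2, abs_of_nonneg (by linarith : 0 ≤ a j + δ), abs_lt]
    constructor <;> linarith
  have hx'i := eq_zero_of_mem_Sol1 hlam hlt hx'
  refine (stsp1_le hx hx' (by simpa using hδ0) (fun k => ?_) fun hs => ?_).trans_lt hδt
  · by_cases hk : k = i
    · subst hk; simp [ha', hij.symm, abs_of_nonneg hδ0]
    · by_cases hk' : k = j
      · subst hk'; simp [ha', hij, abs_of_nonneg hδ0]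
      · simp [ha', hk, hk', hδ0]
  · have : i ∈ supp x' := hs ▸ hxi
    exact this hx'i

lemma stsp1_lt_abs (hlam : 0 < lam) {i : Fin N} (hi : ∀ j, |a j| ≤ |a i|)
    (h : lam < 2 * |y| * |a i|) : stsp1 lam y a < |y| := by
  have hai : 0 < |a i| := by
    refine lt_of_le_of_ne (abs_nonneg _) fun h0 => ?_
    rw [← h0] at h; simp at h; linarith
  have hy : 0 < |y| := by
    refine lt_of_le_of_ne (abs_nonneg _) fun h0 => ?_
    rw [← h0] at h; simp at h; linarith
  obtain ⟨x, hx⟩ := Sol1_nonempty hlam y a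
  set r := lam / (2 * |y| * |a i|) with hr
  have hr0 : 0 < r := by positivity
  have hr1 : r < 1 := by rw [hr, div_lt_one (by positivity)]; exact h
  have hz : (0 : Fin N → ℝ) ∈ Sol1 lam (r * y) a := by
    refine zero_mem_Sol1 fun k => ?_
    calc 2 * |r * y| * |a k| ≤ 2 * |r * y| * |a i| :=
          mul_le_mul_of_nonneg_left (hi k) (by positivity)
      _ = r * (2 * |y| * |a i|) := by rw [abs_mul, abs_of_pos hr0]; ring
      _ = lam := by rw [hr]; field_simp
  have hlt : (1 - r) * |y| < |y| := by nlinarith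
  refine (stsp1_le hx hz ?_ (fun k => ?_)
    (supp_ne_supp_zero (ne_zero_of_mem_Sol1 hlam h hx))).trans_lt hlt
  · rw [← abs_of_pos (sub_pos.2 hr1), ← abs_mul, ← abs_neg]
    exact le_of_eq (by ring_nf)
  · simp only [sub_self, abs_zero]
    nlinarith

lemma stsp1_zero_le (hlam : 0 < lam) {δ : ℝ} (hδ : 0 < δ) {i : Fin N}
    (h : lam < 2 * δ * |a i|) : stsp1 lam 0 a ≤ δ := by
  obtain ⟨x', hx'⟩ := Sol1_nonempty hlam δ a
  refine stsp1_le (x := 0) (zero_mem_Sol1 (by simp [hlam.le])) hx' (by simp [abs_of_pos hδ])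
    (by simp [hδ.le])
    (supp_ne_supp_zero (ne_zero_of_mem_Sol1 hlam (k := i) ?_ hx')).symm
  rwa [abs_of_pos hδ]

end Deterministic

section Probability

lemma nullSingletonClass_expMeasure (r : ℝ) : NullSingletonClass (expMeasure r) :=
  ⟨fun _ => withDensity_absolutelyContinuous _ _ (measure_singleton _)⟩

lemma expMeasure_one_Iic {c : ℝ} (hc : 0 ≤ c) :
    expMeasure 1 (Iic c) = ENNReal.ofReal (1 - Real.exp (-c)) := by
  have := isProbabilityMeasure_expMeasure one_pos
  rw [← ofReal_cdf, cdf_expMeasure_eq one_pos, if_pos hc, one_mul]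

lemma expMeasure_one_Ioi {c : ℝ} (hc : 0 ≤ c) :
    expMeasure 1 (Ioi c) = ENNReal.ofReal (Real.exp (-c)) := by
  have := isProbabilityMeasure_expMeasure one_pos
  have h1 : Real.exp (-c) ≤ 1 := Real.exp_le_one_iff.2 (by linarith)
  rw [← compl_Iic, prob_compl_eq_one_sub measurableSet_Iic, expMeasure_one_Iic hc,
    ← ENNReal.ofReal_one, ← ENNReal.ofReal_sub _ (by linarith), sub_sub_cancel]

lemma expMeasure_one_Ici {c : ℝ} (hc : 0 ≤ c) :
    expMeasure 1 (Ici c) = ENNReal.ofReal (Real.exp (-c)) := by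
  have := nullSingletonClass_expMeasure 1
  rw [← expMeasure_one_Ioi hc]
  exact measure_congr Ioi_ae_eq_Ici.symm

variable {Ω : Type} [MeasurableSpace Ω] {μ : Measure Ω}

lemma measure_add_le_of_exp [IsProbabilityMeasure μ] {X Z : Ω → ℝ}
    (hX : Measurable X) (hZ : Measurable Z)
    (hXZ : IndepFun Z X μ) (hlaw : Measure.map X μ = expMeasure 1) (hZ0 : ∀ ω, 0 ≤ Z ω)
    {s : ℝ} (hs : 0 ≤ s) :
    μ {ω | Z ω + s ≤ X ω} =
      ENNReal.ofReal (Real.exp (-s)) * ∫⁻ ω, ENNReal.ofReal (Real.exp (-Z ω)) ∂μ := by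
  have := isProbabilityMeasure_expMeasure one_pos
  have hm : MeasurableSet {p : ℝ × ℝ | p.1 + s ≤ p.2} :=
    measurableSet_le (by fun_prop) (by fun_prop)
  have h1 : μ {ω | Z ω + s ≤ X ω} = μ.map (fun ω => (Z ω, X ω)) {p : ℝ × ℝ | p.1 + s ≤ p.2} := by
    rw [Measure.map_apply (hZ.prodMk hX) hm]; rfl
  rw [h1, hXZ.map_prod_eq_prod_map_map hZ.aemeasurable hX.aemeasurable, hlaw,
    Measure.prod_apply hm, lintegral_map (measurable_measure_prodMk_left hm) hZ,
    ← lintegral_const_mul _ (by fun_prop)]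
  refine lintegral_congr fun ω => ?_
  have h2 : Prod.mk (Z ω) ⁻¹' {p : ℝ × ℝ | p.1 + s ≤ p.2} = Ici (Z ω + s) := rfl
  rw [h2, expMeasure_one_Ici (add_nonneg (hZ0 ω) hs), ← ENNReal.ofReal_mul (Real.exp_nonneg _),
    ← Real.exp_add]
  congr 2; ring

lemma measure_lt_of_exp [IsProbabilityMeasure μ] {X Z : Ω → ℝ}
    (hX : Measurable X) (hZ : Measurable Z)
    (hXZ : IndepFun Z X μ) (hlaw : Measure.map X μ = expMeasure 1) (hZ0 : ∀ ω, 0 ≤ Z ω) :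
    μ {ω | Z ω < X ω} = ∫⁻ ω, ENNReal.ofReal (Real.exp (-Z ω)) ∂μ := by
  have := isProbabilityMeasure_expMeasure one_pos
  have hm : MeasurableSet {p : ℝ × ℝ | p.1 < p.2} :=
    measurableSet_lt (by fun_prop) (by fun_prop)
  have h1 : μ {ω | Z ω < X ω} = μ.map (fun ω => (Z ω, X ω)) {p : ℝ × ℝ | p.1 < p.2} := by
    rw [Measure.map_apply (hZ.prodMk hX) hm]; rfl
  rw [h1, hXZ.map_prod_eq_prod_map_map hZ.aemeasurable hX.aemeasurable, hlaw,
    Measure.prod_apply hm, lintegral_map (measurable_measure_prodMk_left hm) hZ]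
  refine lintegral_congr fun ω => ?_
  have h2 : Prod.mk (Z ω) ⁻¹' {p : ℝ × ℝ | p.1 < p.2} = Ioi (Z ω) := rfl
  rw [h2, expMeasure_one_Ioi (hZ0 ω)]

/-- The largest absolute value among the entries of `a` other than the `i`-th. -/
def maxAbsOthers {N : ℕ} (a : Fin N → ℝ) (i : Fin N) : ℝ :=
  ‖fun j : ({i}ᶜ : Finset (Fin N)) => a j‖

lemma maxAbsOthers_nonneg {N : ℕ} (a : Fin N → ℝ) (i : Fin N) : 0 ≤ maxAbsOthers a i :=
  norm_nonneg _

lemma abs_le_maxAbsOthers {N : ℕ} (a : Fin N → ℝ) {i j : Fin N} (h : j ≠ i) :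
    |a j| ≤ maxAbsOthers a i :=
  norm_le_pi_norm (fun j : ({i}ᶜ : Finset (Fin N)) => a j) ⟨j, by simpa using h⟩

lemma maxAbsOthers_le {N : ℕ} {a : Fin N → ℝ} {i : Fin N} {c : ℝ} (hc : 0 ≤ c)
    (h : ∀ j, j ≠ i → |a j| ≤ c) : maxAbsOthers a i ≤ c :=
  (pi_norm_le_iff_of_nonneg hc).2 fun j => h j fun hj => by simpa [hj] using j.2

variable {N : ℕ} {A : Ω → Fin N → ℝ}

lemma measurable_maxAbsOthers (hmeas : ∀ i, Measurable fun ω => A ω i) (i : Fin N) :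
    Measurable fun ω => maxAbsOthers (A ω) i :=
  (measurable_pi_lambda _ fun j : ({i}ᶜ : Finset (Fin N)) => hmeas j).norm

lemma indepFun_maxAbsOthers (hmeas : ∀ i, Measurable fun ω => A ω i)
    (hindep : iIndepFun (fun i ω => A ω i) μ) (i : Fin N) :
    IndepFun (fun ω => maxAbsOthers (A ω) i) (fun ω => A ω i) μ := by
  have h := hindep.indepFun_finset {i}ᶜ {i} (by simp) hmeas
  have h1 : Measurable fun v : ({i}ᶜ : Finset (Fin N)) → ℝ => ‖v‖ := measurable_norm
  have h2 : Measurable fun v : ({i} : Finset (Fin N)) → ℝ =>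
    v ⟨i, Finset.mem_singleton_self i⟩ := measurable_pi_apply _
  exact h.comp h1 h2

lemma ae_nonneg_of_exp (hmeas : ∀ i, Measurable fun ω => A ω i)
    (hlaw : ∀ i, Measure.map (fun ω => A ω i) μ = expMeasure 1) :
    ∀ᵐ ω ∂μ, ∀ i, 0 ≤ A ω i := by
  refine ae_all_iff.2 fun i => ?_
  have h : ∀ᵐ x ∂(expMeasure 1), 0 ≤ x := by
    have := isProbabilityMeasure_expMeasure one_pos
    have := expMeasure_one_Ici le_rfl
    simp only [neg_zero, Real.exp_zero, ENNReal.ofReal_one] at this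
    exact (prob_compl_eq_zero_iff measurableSet_Ici).2 this
  rw [← hlaw i] at h
  exact ae_of_ae_map (hmeas i).aemeasurable h

/-- The integrals `𝔼 exp (-max of the other entries)` add up to one, since exactly one entry is
the largest, almost surely. -/
lemma sum_lintegral_exp_neg_maxAbsOthers [IsProbabilityMeasure μ]
    (hN : 0 < N) (hmeas : ∀ i, Measurable fun ω => A ω i)
    (hindep : iIndepFun (fun i ω => A ω i) μ)
    (hlaw : ∀ i, Measure.map (fun ω => A ω i) μ = expMeasure 1) :
    ∑ i, ∫⁻ ω, ENNReal.ofReal (Real.exp (-maxAbsOthers (A ω) i)) ∂μ = 1 := by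
  have hZ := measurable_maxAbsOthers hmeas
  have hI := indepFun_maxAbsOthers hmeas hindep
  have : Nonempty (Fin N) := ⟨⟨0, hN⟩⟩
  apply le_antisymm
  · calc _ = ∑ i, μ {ω | maxAbsOthers (A ω) i < A ω i} :=
          Finset.sum_congr rfl fun i _ => (measure_lt_of_exp (hmeas i) (hZ i) (hI i) (hlaw i)
            fun ω => maxAbsOthers_nonneg _ _).symm
      _ = μ (⋃ i, {ω | maxAbsOthers (A ω) i < A ω i}) := by
          rw [measure_iUnion _ fun i => measurableSet_lt (hZ i) (hmeas i), tsum_fintype]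
          intro i j hij
          refine Set.disjoint_left.2 fun ω h1 h2 => ?_
          rw [Set.mem_ofPred_eq] at h1 h2
          have h3 := abs_le_maxAbsOthers (A ω) hij
          have h4 := abs_le_maxAbsOthers (A ω) hij.symm
          linarith [le_abs_self (A ω i), le_abs_self (A ω j)]
      _ ≤ 1 := prob_le_one
  · calc 1 = μ (⋃ i, {ω | maxAbsOthers (A ω) i + 0 ≤ A ω i}) := by
          symm
          rw [← prob_compl_eq_zero_iff (MeasurableSet.iUnion fun i =>
            measurableSet_le ((hZ i).add_const 0) (hmeas i))]
          change ∀ᵐ ω ∂μ, _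
          filter_upwards [ae_nonneg_of_exp hmeas hlaw] with ω hω
          obtain ⟨i, hi⟩ := Finite.exists_max (A ω)
          refine Set.mem_iUnion.2 ⟨i, ?_⟩
          rw [Set.mem_ofPred_eq, add_zero]
          exact maxAbsOthers_le (hω i) fun j _ => by rw [abs_of_nonneg (hω j)]; exact hi j
      _ ≤ ∑ i, μ {ω | maxAbsOthers (A ω) i + 0 ≤ A ω i} := measure_iUnion_fintype_le _ _
      _ = _ := Finset.sum_congr rfl fun i _ => by
          rw [measure_add_le_of_exp (hmeas i) (hZ i) (hI i) (hlaw i)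
            (fun ω => maxAbsOthers_nonneg _ _) le_rfl]
          simp

/-- The gap between the two largest of finitely many independent standard exponentials is again
standard exponential. -/
lemma measure_gap [IsProbabilityMeasure μ]
    (hN : 0 < N) (hmeas : ∀ i, Measurable fun ω => A ω i)
    (hindep : iIndepFun (fun i ω => A ω i) μ)
    (hlaw : ∀ i, Measure.map (fun ω => A ω i) μ = expMeasure 1) {s : ℝ} (hs : 0 < s) :
    μ (⋃ i, {ω | maxAbsOthers (A ω) i + s ≤ A ω i}) = ENNReal.ofReal (Real.exp (-s)) := by
  have hZ := measurable_maxAbsOthers hmeas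
  have hI := indepFun_maxAbsOthers hmeas hindep
  rw [measure_iUnion _ fun i => measurableSet_le ((hZ i).add_const s) (hmeas i), tsum_fintype]
  · simp_rw [fun i => measure_add_le_of_exp (hmeas i) (hZ i) (hI i) (hlaw i)
      (fun ω => maxAbsOthers_nonneg _ _) hs.le]
    rw [← Finset.mul_sum, sum_lintegral_exp_neg_maxAbsOthers hN hmeas hindep hlaw, mul_one]
  · intro i j hij
    refine Set.disjoint_left.2 fun ω h1 h2 => ?_
    rw [Set.mem_ofPred_eq] at h1 h2
    have h3 := abs_le_maxAbsOthers (A ω) hij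
    have h4 := abs_le_maxAbsOthers (A ω) hij.symm
    linarith [le_abs_self (A ω i), le_abs_self (A ω j)]

lemma measure_forall_le (hindep : iIndepFun (fun i ω => A ω i) μ)
    (hmeas : ∀ i, Measurable fun ω => A ω i)
    (hlaw : ∀ i, Measure.map (fun ω => A ω i) μ = expMeasure 1) {M : ℝ} (hM : 0 ≤ M) :
    μ {ω | ∀ i, A ω i ≤ M} = ENNReal.ofReal (1 - Real.exp (-M)) ^ N := by
  have h := hindep.measure_inter_preimage_eq_mul Finset.univ (sets := fun _ => Iic M)
    fun _ _ => measurableSet_Iic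
  have h1 : ∀ i, μ ((fun ω => A ω i) ⁻¹' Iic M) = ENNReal.ofReal (1 - Real.exp (-M)) := by
    intro i
    rw [← Measure.map_apply (hmeas i) measurableSet_Iic, hlaw, expMeasure_one_Iic hM]
  have h2 : {ω | ∀ i, A ω i ≤ M} = ⋂ i ∈ (Finset.univ : Finset (Fin N)),
      (fun ω => A ω i) ⁻¹' Iic M := by ext; simp
  rw [h2, h]
  simp [h1]

end Probability

/-- Samples with a negative entry, or with no entry above `M`. -/
def atypicalSamples {Ω : Type} {N : ℕ} (A : Ω → Fin N → ℝ) (M : ℝ) : Set Ω :=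
  {ω | ¬ ∀ i, 0 ≤ A ω i} ∪ {ω | ∀ i, A ω i ≤ M}

lemma exists_isMax_of_notMem_atypicalSamples {Ω : Type} {N : ℕ} {A : Ω → Fin N → ℝ} {M : ℝ}
    {ω : Ω} (h : ω ∉ atypicalSamples A M) :
    (∀ i, 0 ≤ A ω i) ∧ ∃ i, M < A ω i ∧ ∀ j, A ω j ≤ A ω i := by
  simp only [atypicalSamples, Set.mem_union, Set.mem_ofPred_eq, not_or, not_forall,
    not_le, not_exists, not_lt] at h
  obtain ⟨h0, k, hk⟩ := h
  have : Nonempty (Fin N) := ⟨k⟩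
  obtain ⟨i, hi⟩ := Finite.exists_max (A ω)
  exact ⟨h0, i, hk.trans_le (hi k), hi⟩

lemma tendsto_measure_atypicalSamples {Ω : Type} [MeasurableSpace Ω] {μ : Measure Ω}
    [IsProbabilityMeasure μ] {A : (N : ℕ) → Ω → Fin N → ℝ}
    (hmeas : ∀ N i, Measurable fun ω => A N ω i)
    (hindep : ∀ N, iIndepFun (fun i ω => A N ω i) μ)
    (hlaw : ∀ N i, Measure.map (fun ω => A N ω i) μ = expMeasure 1) {M : ℝ} (hM : 0 ≤ M) :
    Tendsto (fun N => μ.real (atypicalSamples (A N) M)) atTop (nhds 0) := by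
  have h : ∀ N, μ.real (atypicalSamples (A N) M) ≤ (1 - Real.exp (-M)) ^ N := by
    intro N
    have h0 : 0 ≤ 1 - Real.exp (-M) :=
      sub_nonneg.2 (Real.exp_le_one_iff.2 (by linarith))
    have h1 : μ {ω | ¬ ∀ i, 0 ≤ A N ω i} = 0 := ae_nonneg_of_exp (hmeas N) (hlaw N)
    refine (measureReal_union_le _ _).trans (le_of_eq ?_)
    rw [measureReal_def, measureReal_def, h1,
      measure_forall_le (hindep N) (hmeas N) (hlaw N) hM, ENNReal.toReal_pow,
      ENNReal.toReal_ofReal h0]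
    simp
  refine squeeze_zero (fun _ => measureReal_nonneg) h
    (tendsto_pow_atTop_nhds_zero_of_lt_one ?_ ?_)
  · exact sub_nonneg.2 (Real.exp_le_one_iff.2 (by linarith))
  · linarith [Real.exp_pos (-M)]

/-- For `y ∈ ℝ` fixed and `A ∈ ℝ^{1×N}` with i.i.d. entries following an
exponential distribution with parameter `1`:
`lim_{N→∞} ℙ(stsp(y,A) < t) = 1 − e^{−2t}` for `0 < t < |y|`, and `= 1` for `t ≥ |y|`.
(For `t > 0` the event `{1/t < C_UL(y,A)}` is exactly `{stsp(y,A) < t}`.) -/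
theorem exponential_condition_limit
    (lam : ℝ) (hlam : 0 < lam) (y : ℝ)
    (Ω : Type) [MeasurableSpace Ω] (μ : Measure Ω) [IsProbabilityMeasure μ]
    (A : (N : ℕ) → Ω → Fin N → ℝ)
    (hmeas : ∀ N i, Measurable fun ω => A N ω i)
    (hindep : ∀ N, iIndepFun (fun i ω => A N ω i) μ)
    (hlaw : ∀ N i, Measure.map (fun ω => A N ω i) μ = expMeasure 1)
    (t : ℝ) (ht : 0 < t) :
    (t < |y| →
      Tendsto (fun N : ℕ => (μ {ω | stsp1 lam y (A N ω) < t}).toReal) atTop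
        (nhds (1 - Real.exp (-2 * t)))) ∧
    (|y| ≤ t →
      Tendsto (fun N : ℕ => (μ {ω | stsp1 lam y (A N ω) < t}).toReal) atTop
        (nhds 1)) := by
  have hone : ∀ M : ℝ, 0 ≤ M →
      (∀ N ω, ω ∉ atypicalSamples (A N) M → stsp1 lam y (A N ω) < t) →
      Tendsto (fun N : ℕ => (μ {ω | stsp1 lam y (A N ω) < t}).toReal) atTop (nhds 1) := by
    intro M hM h
    have hB := tendsto_measure_atypicalSamples hmeas hindep hlaw hM
    refine tendsto_of_tendsto_of_tendsto_of_le_of_le (by simpa using hB.const_sub 1)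
      tendsto_const_nhds (fun N => ?_) fun N => measureReal_le_one
    have h1 : μ.real (Set.univ : Set Ω) ≤ μ.real (atypicalSamples (A N) M) +
        μ.real {ω | stsp1 lam y (A N ω) < t} := by
      refine (measureReal_mono fun ω _ => ?_).trans (measureReal_union_le _ _)
      by_cases hω : ω ∈ atypicalSamples (A N) M
      · exact Or.inl hω
      · exact Or.inr (h N ω hω)
    rw [probReal_univ] at h1
    change _ ≤ μ.real _
    linarith
  constructor
  · intro hty
    have hyt : 0 < |y| - t := sub_pos.2 hty
    set M := 2 * t + lam / (2 * (|y| - t)) with hM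
    have hM0 : 0 ≤ M := by positivity
    have hMt : 2 * t < M := lt_add_of_pos_right _ (by positivity)
    have hbig : ∀ c, M < c → lam < 2 * (|y| - t) * (c - t) := by
      intro c hc
      have : lam / (2 * (|y| - t)) < c - t := by linarith
      rw [div_lt_iff₀ (by positivity)] at this
      linarith
    have hbig' : ∀ c, M < c → lam < 2 * |y| * |c| := by
      intro c hc
      have := hbig c hc
      rw [abs_of_pos (by linarith : 0 < c)]
      nlinarith
    set E : ℕ → Set Ω := fun N => ⋃ i, {ω | maxAbsOthers (A N ω) i + 2 * t ≤ A N ω i} with hE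
    have hB := tendsto_measure_atypicalSamples hmeas hindep hlaw hM0
    have hEm : ∀ N, MeasurableSet (E N) := fun N => MeasurableSet.iUnion fun i =>
      measurableSet_le ((measurable_maxAbsOthers (hmeas N) i).add_const _) (hmeas N i)
    have hEc : ∀ N, 0 < N → μ.real (E N)ᶜ = 1 - Real.exp (-2 * t) := by
      intro N hN
      rw [probReal_compl_eq_one_sub (hEm N), measureReal_def,
        measure_gap hN (hmeas N) (hindep N) (hlaw N) (by linarith : 0 < 2 * t),
        ENNReal.toReal_ofReal (Real.exp_nonneg _), neg_mul]
    have hiff : ∀ N ω, ω ∉ atypicalSamples (A N) M →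
        (stsp1 lam y (A N ω) < t ↔ ω ∉ E N) := by
      intro N ω hω
      obtain ⟨h0, i, hi, hmax⟩ := exists_isMax_of_notMem_atypicalSamples hω
      constructor
      · rintro hlt hmem
        obtain ⟨k, hk⟩ := Set.mem_iUnion.1 hmem
        rw [Set.mem_ofPred_eq] at hk
        have hki : k = i := by
          by_contra hne
          have := abs_le_maxAbsOthers (A N ω) (Ne.symm hne)
          linarith [le_abs_self (A N ω i), hmax k]
        subst hki
        refine hlt.not_ge (le_stsp1_of_gap hlam ht hty (i := k) (fun j hj => ?_) (by linarith)
          (hbig _ hi).le)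
        linarith [abs_le_maxAbsOthers (A N ω) hj]
      · intro hmem
        have : ¬ ∀ j, j ≠ i → |A N ω j| ≤ A N ω i - 2 * t := by
          intro hall
          refine hmem (Set.mem_iUnion.2 ⟨i, ?_⟩)
          rw [Set.mem_ofPred_eq]
          linarith [maxAbsOthers_le (a := A N ω) (by linarith) hall]
        push Not at this
        obtain ⟨j, hji, hj⟩ := this
        exact stsp1_lt_of_close hlam hji (fun k => by rw [abs_of_nonneg (h0 k)]; exact hmax k)
          (by linarith) (h0 j) (hbig' _ hi)
    have hlow : Tendsto (fun N => 1 - Real.exp (-2 * t) - μ.real (atypicalSamples (A N) M)) atTop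
        (nhds (1 - Real.exp (-2 * t))) := by simpa using hB.const_sub (1 - Real.exp (-2 * t))
    have hupp : Tendsto (fun N => 1 - Real.exp (-2 * t) + μ.real (atypicalSamples (A N) M)) atTop
        (nhds (1 - Real.exp (-2 * t))) := by simpa using hB.const_add (1 - Real.exp (-2 * t))
    refine tendsto_of_tendsto_of_tendsto_of_le_of_le' hlow hupp ?_ ?_
    · filter_upwards [eventually_gt_atTop 0] with N hN
      have : μ.real (E N)ᶜ ≤ μ.real {ω | stsp1 lam y (A N ω) < t} +
          μ.real (atypicalSamples (A N) M) := by
        refine (measureReal_mono fun ω hω => ?_).trans (measureReal_union_le _ _)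
        by_cases hb : ω ∈ atypicalSamples (A N) M
        · exact Or.inr hb
        · exact Or.inl ((hiff N ω hb).2 hω)
      rw [hEc N hN] at this
      change _ ≤ μ.real _
      linarith
    · filter_upwards [eventually_gt_atTop 0] with N hN
      rw [← hEc N hN]
      refine (measureReal_mono fun ω hω => ?_).trans (measureReal_union_le _ _)
      by_cases hb : ω ∈ atypicalSamples (A N) M
      · exact Or.inr hb
      · exact Or.inl ((hiff N ω hb).1 hω)
  · intro hyt
    by_cases hy : y = 0
    · subst hy
      refine hone (lam / t) (by positivity) fun N ω hω => ?_
      obtain ⟨h0, i, hi, -⟩ := exists_isMax_of_notMem_atypicalSamples hω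
      refine (stsp1_zero_le hlam (half_pos ht) (i := i) ?_).trans_lt (half_lt_self ht)
      rw [div_lt_iff₀ ht] at hi
      rw [abs_of_nonneg (h0 i)]
      linarith
    · have hy0 : 0 < |y| := abs_pos.2 hy
      refine hone (lam / (2 * |y|)) (by positivity) fun N ω hω => ?_
      obtain ⟨h0, i, hi, hmax⟩ := exists_isMax_of_notMem_atypicalSamples hω
      refine (stsp1_lt_abs hlam (i := i) (fun j => ?_) ?_).trans_le hyt
      · rw [abs_of_nonneg (h0 j), abs_of_nonneg (h0 i)]
        exact hmax j
      · rw [div_lt_iff₀ (by positivity)] at hi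
        rw [abs_of_nonneg (h0 i)]
        linarith
end
end

section
/- Let y ∈ ℝ with y ≠ 0 be fixed and let A ∈ ℝ^{1×N} be random with i.i.d. entries following the normal distribution N(μ, σ²) with σ > 0. Then 2√(2 ln N) · stsp(y,A) = 2√(2 ln N) · [C_UL(y,A)]^{−1} converges in distribution, as N → ∞, to an exponential random variable with parameter 1/σ; that is, for every t > 0, lim_{N→∞} ℙ(2√(2 ln N) · stsp(y,A) < t) = 1 − e^{−t/σ}. -/
open MeasureTheory ProbabilityTheory Filter Real Set
open scoped ENNReal NNReal

noncomputable section

/-- The one-row LASSO objective, written out in coordinates. -/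
theorem lassoObj_row {N : ℕ} (lam : ℝ) (y : Fin 1 → ℝ) (A : Matrix (Fin 1) (Fin N) ℝ)
    (x : Fin N → ℝ) :
    lassoObj lam y A x = (∑ j, A 0 j * x j - y 0) ^ 2 + lam * ∑ j, |x j| := by
  simp [lassoObj, Matrix.mulVec, dotProduct]

theorem sq_sub_add_mul_abs_ge (c k s : ℝ) : k * |c| - k ^ 2 / 4 ≤ (s - c) ^ 2 + k * |s| := by
  have h1 : (|s| - |c|) ^ 2 ≤ (s - c) ^ 2 := sq_le_sq.mpr (abs_abs_sub_abs_le_abs_sub s c)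
  nlinarith [sq_nonneg (|s| - |c| + k / 2)]

theorem lassoObj_row_ge {N : ℕ} {lam : ℝ} (hlam : 0 < lam) (y : Fin 1 → ℝ)
    (A : Matrix (Fin 1) (Fin N) ℝ) (i : Fin N) (hi : 0 < |A 0 i|)
    (x : Fin N → ℝ) :
    lam / |A 0 i| * |y 0| - (lam / |A 0 i|) ^ 2 / 4
      + lam / |A 0 i| * ∑ j, (|A 0 i| - |A 0 j|) * |x j| ≤ lassoObj lam y A x := by
  rw [lassoObj_row]
  have h1 := sq_sub_add_mul_abs_ge (y 0) (lam / |A 0 i|) (∑ j, A 0 j * x j)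
  have h2 : |∑ j, A 0 j * x j| ≤ ∑ j, |A 0 j| * |x j| := by
    simpa only [abs_mul] using Finset.abs_sum_le_sum_abs (fun j => A 0 j * x j) Finset.univ
  have h3 : lam / |A 0 i| * ∑ j, (|A 0 i| - |A 0 j|) * |x j|
      = lam * ∑ j, |x j| - lam / |A 0 i| * ∑ j, |A 0 j| * |x j| := by
    simp only [sub_mul, Finset.sum_sub_distrib, ← Finset.mul_sum]
    field_simp
  have h4 := mul_le_mul_of_nonneg_left h2 (div_pos hlam hi).le
  linarith

/-- A maximal entry of a one-row matrix carries a LASSO solution supported on it alone. -/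
theorem exists_mem_Sol_supp_eq_singleton {N : ℕ} {lam : ℝ} (hlam : 0 < lam) (y : Fin 1 → ℝ)
    (A : Matrix (Fin 1) (Fin N) ℝ) (i : Fin N) (hmax : ∀ j, |A 0 j| ≤ |A 0 i|)
    (hbig : lam < 2 * |y 0| * |A 0 i|) :
    ∃ x ∈ Sol lam y A, supp x = {i} ∧
      lassoObj lam y A x = lam / |A 0 i| * |y 0| - (lam / |A 0 i|) ^ 2 / 4 := by
  have hi : 0 < |A 0 i| := by
    rcases (abs_nonneg (A 0 i)).eq_or_lt with h | h
    · rw [← h] at hbig; linarith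
    · exact h
  have hk : lam / |A 0 i| < 2 * |y 0| := by rwa [div_lt_iff₀ hi]
  have hkpos : 0 < lam / |A 0 i| := div_pos hlam hi
  have hy : y 0 ≠ 0 := by
    intro h; rw [h, abs_zero] at hk; linarith
  have hyp : 0 < |y 0| := abs_pos.mpr hy
  have hAi : A 0 i ≠ 0 := abs_pos.mp hi
  set k := lam / |A 0 i| with hkdef
  set v : ℝ := (y 0 / |y 0|) * (|y 0| - k / 2) / A 0 i with hv
  have hd : 0 < |y 0| - k / 2 := by linarith
  have hv0 : v ≠ 0 := by
    refine div_ne_zero (mul_ne_zero (div_ne_zero hy hyp.ne') hd.ne') hAi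
  have hvabs : |v| = (|y 0| - k / 2) / |A 0 i| := by
    rw [hv, abs_div, abs_mul, abs_div, abs_abs, div_self hyp.ne', one_mul, abs_of_pos hd]
  have hobj : lassoObj lam y A (Pi.single i v) = k * |y 0| - k ^ 2 / 4 := by
    rw [lassoObj_row]
    have e1 : ∑ j, A 0 j * (Pi.single i v : Fin N → ℝ) j = A 0 i * v := by
      rw [Finset.sum_eq_single i] <;> simp +contextual
    have e2 : ∑ j, |(Pi.single i v : Fin N → ℝ) j| = |v| := by
      rw [Finset.sum_eq_single i] <;> simp +contextual
    rw [e1, e2, hvabs]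
    have e3 : A 0 i * v = y 0 - k / 2 * (y 0 / |y 0|) := by
      rw [hv]; field_simp
    have e4 : lam * ((|y 0| - k / 2) / |A 0 i|) = k * (|y 0| - k / 2) := by
      rw [hkdef]; ring
    have e5 : (y 0 / |y 0|) ^ 2 = 1 := by
      rw [div_pow, sq_abs, div_self (pow_ne_zero 2 hy)]
    rw [e3, e4]
    linear_combination (k ^ 2 / 4) * e5
  refine ⟨Pi.single i v, fun z => ?_, ?_, hobj⟩
  · rw [hobj]
    have h := lassoObj_row_ge hlam y A i hi z
    have h' : 0 ≤ k * ∑ j, (|A 0 i| - |A 0 j|) * |z j| :=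
      mul_nonneg hkpos.le (Finset.sum_nonneg fun j _ =>
        mul_nonneg (sub_nonneg.mpr (hmax j)) (abs_nonneg _))
    linarith
  · ext j
    by_cases h : j = i
    · subst h; simp [supp, hv0]
    · simp [supp, h]

theorem supp_eq_singleton_of_mem_Sol {N : ℕ} {lam : ℝ} (hlam : 0 < lam) (y : Fin 1 → ℝ)
    (A : Matrix (Fin 1) (Fin N) ℝ) (i : Fin N) (hmax : ∀ j, j ≠ i → |A 0 j| < |A 0 i|)
    (hbig : lam < 2 * |y 0| * |A 0 i|) {x : Fin N → ℝ} (hx : x ∈ Sol lam y A) :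
    supp x = {i} := by
  have hmax' : ∀ j, |A 0 j| ≤ |A 0 i| := fun j => by
    by_cases h : j = i
    · rw [h]
    · exact (hmax j h).le
  have hi : 0 < |A 0 i| := by
    rcases (abs_nonneg (A 0 i)).eq_or_lt with h | h
    · rw [← h] at hbig; linarith
    · exact h
  obtain ⟨x₀, -, -, hobj⟩ := exists_mem_Sol_supp_eq_singleton hlam y A i hmax' hbig
  have hle := (hx x₀).trans_eq hobj
  have hge := lassoObj_row_ge hlam y A i hi x
  have hkpos : 0 < lam / |A 0 i| := div_pos hlam hi
  have hk : lam / |A 0 i| < 2 * |y 0| := by rwa [div_lt_iff₀ hi]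
  have hnn : ∀ j ∈ Finset.univ, 0 ≤ (|A 0 i| - |A 0 j|) * |x j| := fun j _ =>
    mul_nonneg (sub_nonneg.mpr (hmax' j)) (abs_nonneg _)
  have hsum : ∑ j, (|A 0 i| - |A 0 j|) * |x j| = 0 := by
    refine le_antisymm ?_ (Finset.sum_nonneg hnn)
    by_contra! h
    linarith [mul_pos hkpos h]
  have hz : ∀ j, j ≠ i → x j = 0 := fun j hj => by
    have := (Finset.sum_eq_zero_iff_of_nonneg hnn).mp hsum j (Finset.mem_univ j)
    rcases mul_eq_zero.mp this with h | h
    · linarith [hmax j hj]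
    · exact abs_eq_zero.mp h
  have hxi : x i ≠ 0 := fun h => by
    have hx0 : x = 0 := by
      ext j
      by_cases hj : j = i
      · rw [hj, h]; rfl
      · exact hz j hj
    have : lassoObj lam y A x = |y 0| ^ 2 := by
      rw [lassoObj_row, hx0]; simp
    rw [this] at hle
    nlinarith [sq_pos_of_pos (sub_pos.mpr hk)]
  ext j
  simp only [supp, mem_ofPred_eq, mem_singleton_iff]
  exact ⟨fun h => by_contra fun hj => h (hz j hj), fun h => h ▸ hxi⟩

theorem exists_abs_eq_add (a : ℝ) {η : ℝ} (hη : 0 ≤ η) : ∃ b, |b - a| ≤ η ∧ |b| = |a| + η := by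
  rcases le_total 0 a with h | h
  · refine ⟨a + η, by simp [abs_of_nonneg hη], ?_⟩
    rw [abs_of_nonneg h, abs_of_nonneg (by positivity)]
  · refine ⟨a - η, by simp [abs_of_nonneg hη], ?_⟩
    rw [abs_of_nonpos h, abs_of_nonpos (by linarith)]; ring

theorem exists_abs_eq_sub (a : ℝ) {η : ℝ} (hη : 0 ≤ η) (ha : η ≤ |a|) :
    ∃ b, |b - a| ≤ η ∧ |b| = |a| - η := by
  rcases le_total 0 a with h | h
  · rw [abs_of_nonneg h] at ha ⊢
    exact ⟨a - η, by simp [abs_of_nonneg hη], abs_of_nonneg (by linarith)⟩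
  · rw [abs_of_nonpos h] at ha ⊢
    exact ⟨a + η, by simp [abs_of_nonneg hη], by rw [abs_of_nonpos (by linarith)]; ring⟩

theorem two_mul_mul_abs_gt {lam y y' b K δ : ℝ} (hy : y ≠ 0) (hK : lam / |y| + 1 ≤ K)
    (hlam : 0 < lam) (hδy : δ ≤ |y| / 2) (hyy : |y' - y| ≤ δ) (hb : K - 1 < |b|) :
    lam < 2 * |y'| * |b| := by
  have hyp : 0 < |y| := abs_pos.mpr hy
  have h1 : |y| - |y'| ≤ |y' - y| := by rw [abs_sub_comm]; exact abs_sub_abs_le_abs_sub y y'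
  have h2 : lam / |y| < |b| := by linarith
  rw [div_lt_iff₀ hyp] at h2
  nlinarith [abs_nonneg b]

/-- For a row with a large entry and small `δ`, the stability support is at least `δ` exactly when
one entry dominates all others in absolute value by `2 * δ`. -/
theorem le_stsp1_iff {N : ℕ} {lam : ℝ} (hlam : 0 < lam) {y : ℝ} (hy : y ≠ 0) {K δ : ℝ}
    (hK : lam / |y| + 1 ≤ K) (hδ : 0 < δ) (hδ1 : δ ≤ 1) (hδy : δ ≤ |y| / 2) (a : Fin N → ℝ)
    (ha : ∃ i, K < |a i|) :
    δ ≤ stsp1 lam y a ↔ ∃ i, ∀ j, j ≠ i → |a j| + 2 * δ ≤ |a i| := by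
  obtain ⟨i₀, hi₀⟩ := ha
  have hbdd : BddBelow {δ : ℝ | 0 ≤ δ ∧ ∃ (y' : Fin 1 → ℝ) (A' : Matrix (Fin 1) (Fin N) ℝ)
    (x x' : Fin N → ℝ), x ∈ Sol lam (fun _ : Fin 1 => y) (Matrix.of fun _ j => a j) ∧
    x' ∈ Sol lam y' A' ∧ (∀ i, |y' i - y| ≤ δ) ∧ (∀ i j, |A' i j - a j| ≤ δ) ∧
    supp x ≠ supp x'} := ⟨0, fun d hd => hd.1⟩
  constructor
  · intro h
    by_contra! hcon
    have : Nonempty (Fin N) := ⟨i₀⟩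
    obtain ⟨i, -, hi⟩ := Finset.exists_max_image Finset.univ (fun j => |a j|) Finset.univ_nonempty
    obtain ⟨j₀, hj₀, hj₀'⟩ := hcon i
    obtain ⟨j, hj, hjmax⟩ := Finset.exists_max_image (Finset.univ.erase i) (fun j => |a j|)
      ⟨j₀, by simp [hj₀]⟩
    have hji : j ≠ i := by simpa using hj
    have hj2 : |a i| < |a j| + 2 * δ :=
      hj₀'.trans_le (by linarith [hjmax j₀ (by simp [hj₀])])
    have hij : |a j| ≤ |a i| := hi j (Finset.mem_univ j)
    have hiK : K < |a i| := hi₀.trans_le (hi i₀ (Finset.mem_univ _))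
    set η := (|a i| - |a j|) / 2 with hη
    have hη0 : 0 ≤ η := by linarith
    have hηδ : η < δ := by linarith
    obtain ⟨bj, hbj, hbj'⟩ := exists_abs_eq_add (a j) hη0
    obtain ⟨bi, hbi, hbi'⟩ := exists_abs_eq_sub (a i) hη0 (by linarith [abs_nonneg (a j)])
    obtain ⟨x, hx, hxs, -⟩ := exists_mem_Sol_supp_eq_singleton hlam (fun _ : Fin 1 => y)
      (Matrix.of fun _ j => a j) i (fun k => hi k (Finset.mem_univ k))
      (two_mul_mul_abs_gt hy hK hlam hδy (by simpa using hδ.le)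
        (show K - 1 < |a i| by linarith))
    let A' : Matrix (Fin 1) (Fin N) ℝ :=
      Matrix.of fun _ k => Function.update (Function.update a i bi) j bj k
    have hA'j : A' 0 j = bj := by simp [A']
    have hA'i : A' 0 i = bi := by simp [A', Function.update_of_ne hji.symm]
    have hA'k : ∀ l k, k ≠ i → k ≠ j → A' l k = a k := fun l k h1 h2 => by
      simp [A', Function.update_of_ne h1, Function.update_of_ne h2]
    obtain ⟨x', hx', hxs', -⟩ := exists_mem_Sol_supp_eq_singleton hlam (fun _ : Fin 1 => y) A' j
      (fun k => by
        rw [hA'j, hbj']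
        by_cases h1 : k = i
        · rw [h1, hA'i, hbi']; linarith
        by_cases h2 : k = j
        · rw [h2, hA'j, hbj']
        · rw [hA'k 0 k h1 h2]
          linarith [hjmax k (by simp [h1])])
      (two_mul_mul_abs_gt hy hK hlam hδy (by simpa using hδ.le)
        (by rw [hA'j, hbj']; linarith))
    have hle : stsp1 lam y a ≤ η := by
      refine csInf_le hbdd ⟨hη0, fun _ => y, A', x, x', hx, hx', fun _ => by simpa using hη0,
        fun l k => ?_, ?_⟩
      · obtain rfl : l = 0 := Subsingleton.elim _ _
        by_cases h1 : k = i
        · rw [h1, hA'i]; exact hbi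
        by_cases h2 : k = j
        · rw [h2, hA'j]; exact hbj
        · rw [hA'k 0 k h1 h2]; simpa using hη0
      · rw [hxs, hxs']
        simpa using hji.symm
    linarith
  · rintro ⟨i, hi⟩
    have hiK : K < |a i| := by
      by_cases h : i₀ = i
      · rwa [← h]
      · linarith [hi i₀ h]
    have hbig := two_mul_mul_abs_gt (y' := y) hy hK hlam hδy (by simpa using hδ.le)
        (show K - 1 < |a i| by linarith)
    have hlt : ∀ j, j ≠ i → |a j| < |a i| := fun j hj => by linarith [hi j hj]
    have hsol : ∀ x ∈ Sol lam (fun _ : Fin 1 => y) (Matrix.of fun _ j => a j), supp x = {i} :=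
      fun x hx => supp_eq_singleton_of_mem_Sol hlam _ _ i hlt hbig hx
    refine le_csInf ?_ ?_
    · obtain ⟨x, hx, hxs, -⟩ := exists_mem_Sol_supp_eq_singleton hlam (fun _ : Fin 1 => y)
        (Matrix.of fun _ j => a j) i (fun j => by
          by_cases h : j = i
          · rw [h]
          · exact (hlt j h).le) hbig
      refine ⟨|y|, abs_nonneg y, fun _ => 0, Matrix.of fun _ j => a j, x, 0, hx, fun z => ?_,
        by simp, by simp, ?_⟩
      · simp only [lassoObj_row]
        simp only [Pi.zero_apply, mul_zero, Finset.sum_const_zero, abs_zero, sub_zero]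
        have : 0 ≤ lam * ∑ j, |z j| := by positivity
        nlinarith [sq_nonneg (∑ j, (Matrix.of fun (_ : Fin 1) j => a j) 0 j * z j)]
      · rw [hxs]
        intro h
        have : i ∈ supp (0 : Fin N → ℝ) := h ▸ rfl
        simp [supp] at this
    · rintro d ⟨hd0, y', A', x, x', hx, hx', hyy, hAA, hne⟩
      by_contra! hdδ
      refine hne ?_
      rw [hsol x hx]
      have h1 : ∀ j, |A' 0 j| ≤ |a j| + d := fun j => by
        have := abs_sub_abs_le_abs_sub (A' 0 j) (a j)
        have h' := hAA 0 j
        simp only [Matrix.of_apply] at h'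
        linarith
      have h2 : |a i| - d ≤ |A' 0 i| := by
        have := abs_sub_abs_le_abs_sub (a i) (A' 0 i)
        have h' := hAA 0 i
        rw [abs_sub_comm] at h'
        simp only [Matrix.of_apply] at h'
        linarith
      exact (supp_eq_singleton_of_mem_Sol hlam y' A' i
        (fun j hj => by linarith [h1 j, hi j hj])
        (two_mul_mul_abs_gt hy hK hlam hδy ((hyy 0).trans hdδ.le) (by linarith)) hx').symm

theorem measurableSet_dominating_at {N : ℕ} (i : Fin N) (s : ℝ) :
    MeasurableSet {a : Fin N → ℝ | ∀ j, j ≠ i → |a j| + s ≤ |a i|} := by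
  simp only [Set.ofPred_forall]
  refine MeasurableSet.iInter fun j => MeasurableSet.iInter fun _ => ?_
  exact measurableSet_le (by fun_prop) (by fun_prop)

theorem measurableSet_exists_dominating (N : ℕ) (s : ℝ) :
    MeasurableSet {a : Fin N → ℝ | ∃ i, ∀ j, j ≠ i → |a j| + s ≤ |a i|} := by
  rw [Set.ofPred_exists]
  exact MeasurableSet.iUnion fun i => measurableSet_dominating_at i s

theorem measureReal_pi_exists_dominating (γ : Measure ℝ) [IsProbabilityMeasure γ] (n : ℕ) {s : ℝ}
    (hs : 0 < s) :
    (Measure.pi fun _ : Fin (n + 1) => γ).real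
        {a | ∃ i, ∀ j, j ≠ i → |a j| + s ≤ |a i|}
      = (n + 1) * ∫ x, γ.real {z | |z| ≤ |x| - s} ^ n ∂γ := by
  set E : Fin (n + 1) → Set (Fin (n + 1) → ℝ) :=
    fun i => {a | ∀ j, j ≠ i → |a j| + s ≤ |a i|} with hE
  have hunion : {a : Fin (n + 1) → ℝ | ∃ i, ∀ j, j ≠ i → |a j| + s ≤ |a i|} = ⋃ i, E i := by
    ext a; simp [hE]
  have hmeasE : ∀ i, MeasurableSet (E i) := fun i => measurableSet_dominating_at i s
  have hdisj : Pairwise (Function.onFun Disjoint E) := fun i j hij => by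
    refine Set.disjoint_left.mpr fun a hi hj => ?_
    have h1 := hi j hij.symm
    have h2 := hj i hij
    linarith
  have hT : MeasurableSet {p : ℝ × ℝ | |p.2| ≤ |p.1| - s} :=
    measurableSet_le (by fun_prop) (by fun_prop)
  have hE_eq : ∀ i, (Measure.pi fun _ : Fin (n + 1) => γ) (E i)
      = ∫⁻ x, γ {z | |z| ≤ |x| - s} ^ n ∂γ := fun i => by
    have hS : MeasurableSet {p : ℝ × (Fin n → ℝ) | ∀ j, |p.2 j| ≤ |p.1| - s} := by
      simp only [Set.ofPred_forall]
      exact MeasurableSet.iInter fun j => measurableSet_le (by fun_prop) (by fun_prop)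
    have hpre : E i = MeasurableEquiv.piFinSuccAbove (fun _ => ℝ) i ⁻¹'
        {p : ℝ × (Fin n → ℝ) | ∀ j, |p.2 j| ≤ |p.1| - s} := by
      ext a
      simp only [hE, Set.mem_ofPred_eq, Set.mem_preimage, Fin.forall_iff_succAbove i,
        MeasurableEquiv.piFinSuccAbove_apply, le_sub_iff_add_le]
      simp [Fin.succAbove_ne, Fin.insertNthEquiv, Fin.removeNth]
    rw [hpre, (measurePreserving_piFinSuccAbove (fun _ : Fin (n + 1) => γ) i).measure_preimage
      hS.nullMeasurableSet, Measure.prod_apply hS]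
    refine lintegral_congr fun x => ?_
    have : Prod.mk x ⁻¹' {p : ℝ × (Fin n → ℝ) | ∀ j, |p.2 j| ≤ |p.1| - s}
        = Set.univ.pi fun _ => {z | |z| ≤ |x| - s} := by
      ext; simp
    rw [this, Measure.pi_pi]
    simp
  have hmeas : Measurable fun x => γ {z | |z| ≤ |x| - s} :=
    measurable_measure_prodMk_left hT
  rw [hunion, measureReal_def, measure_iUnion hdisj hmeasE]
  simp only [hE_eq, tsum_fintype, Finset.sum_const, Finset.card_univ, Fintype.card_fin,
    nsmul_eq_mul, ENNReal.toReal_mul, ENNReal.toReal_natCast]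
  rw [← integral_toReal (hmeas.pow_const n).aemeasurable
    (ae_of_all _ fun x => ENNReal.pow_lt_top (measure_lt_top _ _))]
  simp [measureReal_def]

/-- The density on `[0, ∞)` of the absolute value of a Gaussian variable. -/
def foldedPDF (m : ℝ) (v : ℝ≥0) (x : ℝ) : ℝ := gaussianPDFReal m v x + gaussianPDFReal m v (-x)

/-- The distribution function on `[0, ∞)` of the absolute value of a Gaussian variable. -/
def foldedCDF (m : ℝ) (v : ℝ≥0) (r : ℝ) : ℝ := ∫ x in (0 : ℝ)..r, foldedPDF m v x

theorem continuous_gaussianPDFReal (m : ℝ) (v : ℝ≥0) : Continuous (gaussianPDFReal m v) := by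
  unfold gaussianPDFReal
  fun_prop

theorem continuous_foldedPDF (m : ℝ) (v : ℝ≥0) : Continuous (foldedPDF m v) :=
  (continuous_gaussianPDFReal m v).add ((continuous_gaussianPDFReal m v).comp continuous_neg)

theorem foldedPDF_nonneg (m : ℝ) (v : ℝ≥0) (x : ℝ) : 0 ≤ foldedPDF m v x :=
  add_nonneg (gaussianPDFReal_nonneg _ _ _) (gaussianPDFReal_nonneg _ _ _)

theorem integrable_foldedPDF (m : ℝ) (v : ℝ≥0) : Integrable (foldedPDF m v) :=
  (integrable_gaussianPDFReal m v).add (integrable_gaussianPDFReal m v).comp_neg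

theorem foldedPDF_neg (m : ℝ) (v : ℝ≥0) (x : ℝ) : foldedPDF m v (-x) = foldedPDF m v x := by
  simp [foldedPDF, add_comm]

theorem foldedPDF_abs (m : ℝ) (v : ℝ≥0) (x : ℝ) : foldedPDF m v |x| = foldedPDF m v x := by
  rcases abs_choice x with h | h <;> rw [h]
  exact foldedPDF_neg m v x

theorem hasDerivAt_foldedCDF (m : ℝ) (v : ℝ≥0) (r : ℝ) :
    HasDerivAt (foldedCDF m v) (foldedPDF m v r) r :=
  intervalIntegral.integral_hasDerivAt_right (integrable_foldedPDF m v).intervalIntegrable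
    (continuous_foldedPDF m v).stronglyMeasurable.stronglyMeasurableAtFilter
    (continuous_foldedPDF m v).continuousAt

theorem continuous_foldedCDF (m : ℝ) (v : ℝ≥0) : Continuous (foldedCDF m v) :=
  continuous_iff_continuousAt.mpr fun r => (hasDerivAt_foldedCDF m v r).continuousAt

theorem foldedCDF_zero (m : ℝ) (v : ℝ≥0) : foldedCDF m v 0 = 0 := by
  simp [foldedCDF]

theorem measureReal_abs_le {m : ℝ} {v : ℝ≥0} (hv : v ≠ 0) {r : ℝ} (hr : 0 ≤ r) :
    (gaussianReal m v).real {z | |z| ≤ r} = foldedCDF m v r := by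
  have hset : {z : ℝ | |z| ≤ r} = Icc (-r) r := by ext; simp [abs_le]
  have hi := integrable_gaussianPDFReal m v
  rw [measureReal_def, gaussianReal_apply_eq_integral m hv, ENNReal.toReal_ofReal
    (integral_nonneg fun _ => gaussianPDFReal_nonneg _ _ _), hset, integral_Icc_eq_integral_Ioc,
    ← intervalIntegral.integral_of_le (by linarith),
    ← intervalIntegral.integral_add_adjacent_intervals (b := 0) hi.intervalIntegrable
      hi.intervalIntegrable, foldedCDF]
  simp only [foldedPDF]
  rw [intervalIntegral.integral_add hi.intervalIntegrable hi.comp_neg.intervalIntegrable,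
    intervalIntegral.integral_comp_neg (fun x => gaussianPDFReal m v x)]
  simp [add_comm]

theorem measureReal_abs_le_eq_max {m : ℝ} {v : ℝ≥0} (hv : v ≠ 0) (r : ℝ) :
    (gaussianReal m v).real {z | |z| ≤ r} = foldedCDF m v (max r 0) := by
  rcases le_or_gt 0 r with h | h
  · rw [max_eq_left h, measureReal_abs_le hv h]
  · have : {z : ℝ | |z| ≤ r} = ∅ := by
      ext z
      simp only [Set.mem_ofPred_eq, Set.mem_empty_iff_false, iff_false, not_le]
      exact h.trans_le (abs_nonneg z)
    rw [this, max_eq_right h.le, foldedCDF_zero, measureReal_empty]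

theorem foldedCDF_mem_Icc {m : ℝ} {v : ℝ≥0} (hv : v ≠ 0) {r : ℝ} (hr : 0 ≤ r) :
    foldedCDF m v r ∈ Icc 0 1 := by
  rw [← measureReal_abs_le hv hr]
  exact ⟨measureReal_nonneg, measureReal_le_one⟩

theorem integral_comp_abs_gaussianReal {m : ℝ} {v : ℝ≥0} (hv : v ≠ 0) {g : ℝ → ℝ}
    (hg : Measurable g) (hg1 : ∀ x, ‖g x‖ ≤ 1) :
    ∫ x, g |x| ∂gaussianReal m v = ∫ x in Ioi 0, foldedPDF m v x * g x := by
  have hga : AEStronglyMeasurable (fun x => g |x|) volume :=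
    (hg.comp measurable_norm).aestronglyMeasurable
  have h1 : Integrable fun x => gaussianPDFReal m v x * g |x| :=
    (integrable_gaussianPDFReal m v).mul_bdd (c := 1) hga (ae_of_all _ fun x => hg1 _)
  have h2 : Integrable fun x => gaussianPDFReal m v (-x) * g |x| :=
    (integrable_gaussianPDFReal m v).comp_neg.mul_bdd (c := 1) hga (ae_of_all _ fun x => hg1 _)
  rw [integral_gaussianReal_eq_integral_smul hv]
  simp only [smul_eq_mul]
  have h3 : ∫ x, gaussianPDFReal m v (-x) * g |x| = ∫ x, gaussianPDFReal m v x * g |x| := by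
    rw [← integral_neg_eq_self]; simp
  have h4 : ∫ x, foldedPDF m v x * g |x| = 2 * ∫ x in Ioi 0, foldedPDF m v x * g x := by
    rw [← integral_comp_abs (f := fun x => foldedPDF m v x * g x)]
    simp only [foldedPDF_abs]
  simp only [foldedPDF, add_mul] at h4 ⊢
  rw [integral_add h1 h2, h3] at h4
  linarith

theorem integral_Ioi_foldedPDF_mul_shift {m : ℝ} {v : ℝ≥0} {n : ℕ} (hn : n ≠ 0) {s : ℝ}
    (hs : 0 ≤ s) :
    ∫ x in Ioi 0, foldedPDF m v x * foldedCDF m v (max (x - s) 0) ^ n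
      = ∫ u in Ioi 0, foldedCDF m v u ^ n * foldedPDF m v (u + s) := by
  rw [← integral_indicator measurableSet_Ioi, ← integral_indicator measurableSet_Ioi,
    ← integral_add_right_eq_self _ s]
  refine integral_congr_ae (ae_of_all _ fun u => ?_)
  simp only [indicator_apply, mem_Ioi, add_sub_cancel_right]
  rcases le_or_gt u 0 with h | h
  · simp [max_eq_right h, foldedCDF_zero, hn, not_lt.mpr h]
  · rw [if_pos h, if_pos (by linarith), max_eq_left h.le, mul_comm]

theorem measureReal_pi_gaussianReal_dominating {m : ℝ} {v : ℝ≥0} (hv : v ≠ 0) {n : ℕ}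
    (hn : n ≠ 0) {s : ℝ} (hs : 0 < s) :
    (Measure.pi fun _ : Fin (n + 1) => gaussianReal m v).real
        {a | ∃ i, ∀ j, j ≠ i → |a j| + s ≤ |a i|}
      = (n + 1) * ∫ u in Ioi 0, foldedCDF m v u ^ n * foldedPDF m v (u + s) := by
  rw [measureReal_pi_exists_dominating _ _ hs, ← integral_Ioi_foldedPDF_mul_shift hn hs.le]
  simp only [measureReal_abs_le_eq_max hv]
  rw [integral_comp_abs_gaussianReal (g := fun x => foldedCDF m v (max (x - s) 0) ^ n) hv]
  · exact (((continuous_foldedCDF m v).comp (by fun_prop)).pow n).measurable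
  · intro x
    have h := foldedCDF_mem_Icc (m := m) hv (le_max_right (x - s) 0)
    rw [norm_pow, norm_of_nonneg h.1]
    exact pow_le_one₀ h.1 h.2

theorem tendsto_foldedCDF_atTop {m : ℝ} {v : ℝ≥0} (hv : v ≠ 0) :
    Tendsto (foldedCDF m v) atTop (nhds 1) := by
  have h := intervalIntegral_tendsto_integral_Ioi (0 : ℝ)
    (integrable_foldedPDF m v).integrableOn tendsto_id
  have h1 := integral_comp_abs_gaussianReal (m := m) hv (g := fun _ => 1) measurable_const
    (by simp)
  simp only [integral_const, probReal_univ, smul_eq_mul, mul_one] at h1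
  rw [← h1] at h
  exact h

theorem hasDerivAt_foldedCDF_pow (m : ℝ) (v : ℝ≥0) (n : ℕ) (r : ℝ) :
    HasDerivAt (fun u => foldedCDF m v u ^ (n + 1))
      ((n + 1) * (foldedCDF m v r ^ n * foldedPDF m v r)) r := by
  have h := (hasDerivAt_foldedCDF m v r).fun_pow (n + 1)
  simp only [Nat.add_sub_cancel, Nat.cast_add, Nat.cast_one] at h
  simpa only [mul_assoc] using h

theorem integral_Ioc_foldedCDF_pow {m : ℝ} {v : ℝ≥0} (n : ℕ) {b : ℝ} (hb : 0 ≤ b) :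
    (n + 1) * ∫ u in Ioc 0 b, foldedCDF m v u ^ n * foldedPDF m v u
      = foldedCDF m v b ^ (n + 1) := by
  rw [← intervalIntegral.integral_of_le hb, ← intervalIntegral.integral_const_mul,
    intervalIntegral.integral_eq_sub_of_hasDerivAt
      (fun x _ => hasDerivAt_foldedCDF_pow m v n x)]
  · simp [foldedCDF_zero]
  · exact (continuous_const.mul (((continuous_foldedCDF m v).pow n).mul
      (continuous_foldedPDF m v))).intervalIntegrable _ _

theorem integrableOn_foldedCDF_pow_mul {m : ℝ} {v : ℝ≥0} (hv : v ≠ 0) (n : ℕ) (s : ℝ) :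
    IntegrableOn (fun u => foldedCDF m v u ^ n * foldedPDF m v (u + s)) (Ioi 0) := by
  refine Integrable.bdd_mul (c := 1) ((integrable_foldedPDF m v).comp_add_right s).integrableOn
    ((continuous_foldedCDF m v).pow n).aestronglyMeasurable ?_
  refine (ae_restrict_iff' measurableSet_Ioi).mpr (ae_of_all _ fun u hu => ?_)
  have h := foldedCDF_mem_Icc (m := m) hv (le_of_lt hu)
  rw [norm_pow, norm_of_nonneg h.1]
  exact pow_le_one₀ h.1 h.2

theorem integral_Ioi_foldedCDF_pow {m : ℝ} {v : ℝ≥0} (hv : v ≠ 0) (n : ℕ) :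
    (n + 1) * ∫ u in Ioi 0, foldedCDF m v u ^ n * foldedPDF m v u = 1 := by
  rw [← integral_const_mul, integral_Ioi_of_hasDerivAt_of_tendsto'
    (fun x _ => hasDerivAt_foldedCDF_pow m v n x) ?_ ((tendsto_foldedCDF_atTop hv).pow (n + 1))]
  · simp [foldedCDF_zero]
  · have h := integrableOn_foldedCDF_pow_mul (m := m) hv n 0
    simp only [add_zero] at h
    exact h.const_mul _

theorem gaussianPDFReal_add_eq_mul_exp {m : ℝ} {v : ℝ≥0} (hv : v ≠ 0) (x s : ℝ) :
    gaussianPDFReal m v (x + s)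
      = gaussianPDFReal m v x * rexp (-(x * s / v)) * rexp (m * s / v - s ^ 2 / (2 * v)) := by
  have hv' : (v : ℝ) ≠ 0 := by exact_mod_cast hv
  simp only [gaussianPDFReal]
  rw [mul_assoc, mul_assoc, mul_assoc (√(2 * (π * (v : ℝ))))⁻¹, ← Real.exp_add, ← Real.exp_add]
  congr 2
  field_simp
  ring

theorem foldedPDF_add_le {m : ℝ} {v : ℝ≥0} (hv : v ≠ 0) (u : ℝ) {s : ℝ} (hs : 0 ≤ s) :
    foldedPDF m v (u + s) ≤ foldedPDF m v u * rexp (-(u * s / v)) * rexp (|m| * s / v) := by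
  have hv' : 0 < (v : ℝ) := by exact_mod_cast pos_iff_ne_zero.mpr hv
  have hs2 : 0 ≤ s ^ 2 / (2 * v) := by positivity
  have h1 : m * s / v ≤ |m| * s / v := by gcongr; exact le_abs_self m
  have h2 : -m * s / v ≤ |m| * s / v := by gcongr; exact neg_le_abs m
  simp only [foldedPDF, neg_add, gaussianPDFReal_add_eq_mul_exp hv, add_mul]
  have e1 : -(-u * -s / (v : ℝ)) = -(u * s / v) := by ring
  rw [e1]
  have hp := gaussianPDFReal_nonneg m v
  have hu := hp u
  have hu' := hp (-u)
  gcongr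
  · linarith
  · rw [neg_sq]
    have : m * -s / (v : ℝ) = -m * s / v := by ring
    linarith

theorem foldedPDF_add_ge {m : ℝ} {v : ℝ≥0} (hv : v ≠ 0) (u : ℝ) {s : ℝ} (hs : 0 ≤ s) :
    foldedPDF m v u * rexp (-(u * s / v)) * rexp (-(|m| * s / v) - s ^ 2 / (2 * v))
      ≤ foldedPDF m v (u + s) := by
  have hv' : 0 < (v : ℝ) := by exact_mod_cast pos_iff_ne_zero.mpr hv
  have h1 : m * s / v ≤ |m| * s / v := by gcongr; exact le_abs_self m
  have h2 : -m * s / v ≤ |m| * s / v := by gcongr; exact neg_le_abs m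
  have e2 : -m * s / (v : ℝ) = -(m * s / v) := by ring
  simp only [foldedPDF, neg_add, gaussianPDFReal_add_eq_mul_exp hv, add_mul]
  have e1 : -(-u * -s / (v : ℝ)) = -(u * s / v) := by ring
  rw [e1, neg_sq]
  have hp := gaussianPDFReal_nonneg m v
  have hu := hp u
  have hu' := hp (-u)
  gcongr
  · linarith
  · have : m * -s / (v : ℝ) = -m * s / v := by ring
    linarith

theorem dominating_probability_ge {m : ℝ} {v : ℝ≥0} (hv : v ≠ 0) (n : ℕ) {s b : ℝ}
    (hs : 0 ≤ s) (hb : 0 ≤ b) :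
    rexp (-(|m| * s / v) - s ^ 2 / (2 * v)) * rexp (-(b * s / v)) * foldedCDF m v b ^ (n + 1)
      ≤ (n + 1) * ∫ u in Ioi 0, foldedCDF m v u ^ n * foldedPDF m v (u + s) := by
  rw [← integral_Ioc_foldedCDF_pow n hb, mul_left_comm]
  refine mul_le_mul_of_nonneg_left ?_ (by positivity)
  have hint := integrableOn_foldedCDF_pow_mul (m := m) hv n s
  calc _ = ∫ u in Ioc 0 b, rexp (-(|m| * s / v) - s ^ 2 / (2 * v)) * rexp (-(b * s / v))
          * (foldedCDF m v u ^ n * foldedPDF m v u) := (integral_const_mul _ _).symm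
    _ ≤ ∫ u in Ioc 0 b, foldedCDF m v u ^ n * foldedPDF m v (u + s) := by
        refine setIntegral_mono_on ?_ (hint.mono_set Ioc_subset_Ioi_self) measurableSet_Ioc
          fun u hu => ?_
        · exact ((by simpa using integrableOn_foldedCDF_pow_mul (m := m) hv n 0 :
            IntegrableOn (fun u => foldedCDF m v u ^ n * foldedPDF m v u) (Ioi 0)).mono_set
            Ioc_subset_Ioi_self).const_mul _
        · have hF := (foldedCDF_mem_Icc (m := m) hv hu.1.le).1
          have hf := foldedPDF_nonneg m v u
          rw [mul_left_comm]
          refine mul_le_mul_of_nonneg_left ((le_of_eq ?_).trans ((mul_le_mul_of_nonneg_right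
            (mul_le_mul_of_nonneg_left (?_ : rexp (-(b * s / v)) ≤ rexp (-(u * s / v))) hf)
            (Real.exp_nonneg _)).trans (foldedPDF_add_ge hv u hs))) (by positivity)
          · ring
          · have := hu.2
            gcongr
    _ ≤ _ := by
        refine setIntegral_mono_set hint ?_ Ioc_subset_Ioi_self.eventuallyLE
        refine (ae_restrict_iff' measurableSet_Ioi).mpr (ae_of_all _ fun u hu => ?_)
        exact mul_nonneg (pow_nonneg (foldedCDF_mem_Icc (m := m) hv (le_of_lt hu)).1 n)
          (foldedPDF_nonneg _ _ _)

theorem dominating_probability_le {m : ℝ} {v : ℝ≥0} (hv : v ≠ 0) (n : ℕ) {s a : ℝ}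
    (hs : 0 ≤ s) (ha : 0 ≤ a) :
    (n + 1) * ∫ u in Ioi 0, foldedCDF m v u ^ n * foldedPDF m v (u + s)
      ≤ rexp (|m| * s / v) * (foldedCDF m v a ^ (n + 1) + rexp (-(a * s / v))) := by
  have hint := integrableOn_foldedCDF_pow_mul (m := m) hv n s
  have hint0 : IntegrableOn (fun u => foldedCDF m v u ^ n * foldedPDF m v u) (Ioi 0) := by
    simpa using integrableOn_foldedCDF_pow_mul (m := m) hv n 0
  have hnn : ∀ u ∈ Ioi (0 : ℝ), 0 ≤ foldedCDF m v u ^ n * foldedPDF m v u := fun u hu =>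
    mul_nonneg (pow_nonneg (foldedCDF_mem_Icc (m := m) hv (le_of_lt hu)).1 n)
      (foldedPDF_nonneg _ _ _)
  have hle : ∀ u ∈ Ioi (0 : ℝ), foldedCDF m v u ^ n * foldedPDF m v (u + s)
      ≤ rexp (|m| * s / v) * ((Ioc 0 a).indicator
          (fun u => foldedCDF m v u ^ n * foldedPDF m v u) u
        + rexp (-(a * s / v)) * (foldedCDF m v u ^ n * foldedPDF m v u)) := fun u hu => by
    have hF := (foldedCDF_mem_Icc (m := m) hv (le_of_lt hu)).1
    have h1 := mul_le_mul_of_nonneg_left (foldedPDF_add_le (m := m) hv u hs) (pow_nonneg hF n)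
    have h0 := hnn u hu
    refine h1.trans ?_
    have e : foldedCDF m v u ^ n *
        (foldedPDF m v u * rexp (-(u * s / v)) * rexp (|m| * s / v))
      = rexp (|m| * s / v) *
        (rexp (-(u * s / v)) * (foldedCDF m v u ^ n * foldedPDF m v u)) := by ring
    rw [e]
    refine mul_le_mul_of_nonneg_left ?_ (Real.exp_nonneg _)
    have hu0 : (0 : ℝ) < u := hu
    rcases le_or_gt u a with h | h
    · rw [indicator_of_mem (show u ∈ Ioc 0 a from ⟨hu0, h⟩)]
      have h2 : rexp (-(u * s / v)) ≤ 1 := by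
        rw [Real.exp_le_one_iff, neg_nonpos]; positivity
      have h3 : 0 ≤ rexp (-(a * s / v)) := Real.exp_nonneg _
      nlinarith
    · rw [indicator_of_notMem (fun h' => absurd h'.2 (not_le.mpr h)), zero_add]
      gcongr
  have hind : IntegrableOn ((Ioc 0 a).indicator
      (fun u => foldedCDF m v u ^ n * foldedPDF m v u)) (Ioi 0) :=
    hint0.indicator measurableSet_Ioc
  have hmono := setIntegral_mono_on hint ((hind.add (hint0.const_mul (rexp (-(a * s / v))))).const_mul
    (rexp (|m| * s / v))) measurableSet_Ioi hle
  have e1 : ∫ u in Ioi 0, (Ioc 0 a).indicator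
      (fun u => foldedCDF m v u ^ n * foldedPDF m v u) u
      = ∫ u in Ioc 0 a, foldedCDF m v u ^ n * foldedPDF m v u := by
    rw [setIntegral_indicator measurableSet_Ioc, inter_eq_right.mpr Ioc_subset_Ioi_self]
  simp only [Pi.add_apply] at hmono
  rw [integral_const_mul, integral_add hind (hint0.const_mul _), e1, integral_const_mul] at hmono
  have hI := integral_Ioi_foldedCDF_pow (m := m) hv n
  have hJ := integral_Ioc_foldedCDF_pow (m := m) (v := v) n ha
  refine (mul_le_mul_of_nonneg_left hmono (by positivity : (0 : ℝ) ≤ n + 1)).trans_eq ?_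
  linear_combination rexp (|m| * s / v) * hJ + rexp (|m| * s / v) * rexp (-(a * s / v)) * hI

theorem one_sub_foldedCDF_le {m : ℝ} {v : ℝ≥0} (hv : v ≠ 0) {r θ : ℝ} (hr : 0 ≤ r)
    (hθ : 0 ≤ θ) :
    1 - foldedCDF m v r ≤ 2 * rexp (-θ * r + |m| * θ + v * θ ^ 2 / 2) := by
  have hcompl : {z : ℝ | |z| ≤ r}ᶜ ⊆ {z | r ≤ z} ∪ {z | z ≤ -r} := fun z hz => by
    simp only [Set.mem_compl_iff, Set.mem_ofPred_eq, not_le] at hz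
    rcases lt_abs.mp hz with h | h
    · exact Or.inl h.le
    · exact Or.inr (by simp only [Set.mem_ofPred_eq]; linarith)
  have h1 := measure_ge_le_exp_mul_mgf (μ := gaussianReal m v) (X := fun x => x) r hθ
    (integrable_exp_mul_gaussianReal θ)
  have h2 := measure_le_le_exp_mul_mgf (μ := gaussianReal m v) (X := fun x => x) (-r)
    (neg_nonpos.mpr hθ) (integrable_exp_mul_gaussianReal (-θ))
  simp only [mgf_fun_id_gaussianReal, ← Real.exp_add] at h1 h2
  have hm1 : m * θ ≤ |m| * θ := by gcongr; exact le_abs_self m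
  have hm2 : -m * θ ≤ |m| * θ := by gcongr; exact neg_le_abs m
  have h1' := h1.trans (Real.exp_le_exp.mpr
    (by linarith : _ ≤ -θ * r + |m| * θ + v * θ ^ 2 / 2))
  have h2' := h2.trans (Real.exp_le_exp.mpr
    (by rw [neg_sq]; linarith : _ ≤ -θ * r + |m| * θ + v * θ ^ 2 / 2))
  have h3 := probReal_compl_eq_one_sub (μ := gaussianReal m v)
    (measurableSet_le measurable_norm measurable_const : MeasurableSet {z : ℝ | |z| ≤ r})
  rw [measureReal_abs_le hv hr] at h3
  rw [← h3]
  refine (measureReal_mono hcompl).trans ((measureReal_union_le _ _).trans ?_)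
  linarith

theorem foldedCDF_le_one_sub {m : ℝ} {v : ℝ≥0} (hv : v ≠ 0) {r : ℝ} (hr : 0 ≤ r) :
    foldedCDF m v r ≤ 1 - (√(2 * π * v))⁻¹ * rexp (-(r + 1 + |m|) ^ 2 / (2 * v)) := by
  obtain ⟨c, hc, hfc⟩ := exists_hasDerivAt_eq_slope (foldedCDF m v) (foldedPDF m v)
    (lt_add_one r) (continuous_foldedCDF m v).continuousOn
    (fun x _ => hasDerivAt_foldedCDF m v x)
  rw [add_sub_cancel_left, div_one] at hfc
  have h1 := (foldedCDF_mem_Icc (m := m) hv (by linarith : 0 ≤ r + 1)).2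
  have h2 : (√(2 * π * v))⁻¹ * rexp (-(r + 1 + |m|) ^ 2 / (2 * v)) ≤ foldedPDF m v c := by
    refine le_add_of_le_of_nonneg ?_ (gaussianPDFReal_nonneg _ _ _)
    rw [gaussianPDFReal]
    have h3 : (c - m) ^ 2 ≤ (r + 1 + |m|) ^ 2 := by
      have h4 := le_abs_self m
      have h5 := neg_abs_le m
      obtain ⟨h6, h7⟩ := hc
      exact sq_le_sq' (by linarith) (by linarith)
    gcongr
  linarith

theorem foldedCDF_lt_one {m : ℝ} {v : ℝ≥0} (hv : v ≠ 0) {r : ℝ} (hr : 0 ≤ r) :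
    foldedCDF m v r < 1 := by
  have hv' : 0 < (v : ℝ) := by exact_mod_cast pos_iff_ne_zero.mpr hv
  refine (foldedCDF_le_one_sub hv hr).trans_lt (sub_lt_self _ (by positivity))

theorem tendsto_sqrt_two_mul_log_atTop :
    Tendsto (fun N : ℕ => √(2 * Real.log N)) atTop atTop :=
  Real.tendsto_sqrt_atTop.comp ((Real.tendsto_log_atTop.comp
    tendsto_natCast_atTop_atTop).const_mul_atTop two_pos)

theorem natCast_eq_exp_sqrt_two_mul_log_sq {N : ℕ} (hN : 1 ≤ N) :
    (N : ℝ) = rexp (√(2 * Real.log N) ^ 2 / 2) := by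
  have h1 : (1 : ℝ) ≤ N := by exact_mod_cast hN
  rw [Real.sq_sqrt (mul_nonneg two_pos.le (Real.log_nonneg h1)),
    mul_div_cancel_left₀ _ two_ne_zero, Real.exp_log (by linarith)]

theorem tendsto_mul_linear_sub_atTop {α : ℝ} (hα : 0 < α) (β κ : ℝ) :
    Tendsto (fun N : ℕ => √(2 * Real.log N) * (α * √(2 * Real.log N) - β) - κ) atTop atTop := by
  have h := tendsto_sqrt_two_mul_log_atTop
  have h1 := tendsto_atTop_add_const_right atTop (-β) (h.const_mul_atTop hα)
  simpa only [sub_eq_add_neg] using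
    tendsto_atTop_add_const_right atTop (-κ) (h.atTop_mul_atTop₀ h1)

theorem tendsto_foldedCDF_pow_nhds_zero (m : ℝ) {σ : ℝ≥0} (hσ : 0 < σ) {c : ℝ} (hc : 0 ≤ c)
    (hcσ : c < σ) :
    Tendsto (fun N : ℕ => foldedCDF m (σ ^ 2) (c * √(2 * Real.log N)) ^ N) atTop (nhds 0) := by
  have hv : σ ^ 2 ≠ 0 := (pow_pos hσ 2).ne'
  have hσ' : (0 : ℝ) < σ := by exact_mod_cast hσ
  set C : ℝ := (√(2 * π * (σ ^ 2 : ℝ≥0)))⁻¹ with hC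
  have hCpos : 0 < C := by
    have : (0 : ℝ) < (σ ^ 2 : ℝ≥0) := by exact_mod_cast pow_pos hσ 2
    positivity
  have hα : 0 < 1 / 2 - c ^ 2 / (2 * (σ : ℝ) ^ 2) := by
    have h1 : c ^ 2 / (2 * (σ : ℝ) ^ 2) < 1 / 2 := by
      rw [div_lt_div_iff₀ (by positivity) two_pos]
      nlinarith
    linarith
  have hlim := Real.tendsto_exp_neg_atTop_nhds_zero.comp
    ((Real.tendsto_exp_atTop.comp (tendsto_mul_linear_sub_atTop hα
      (c * (1 + |m|) / (σ : ℝ) ^ 2) ((1 + |m|) ^ 2 / (2 * (σ : ℝ) ^ 2)))).const_mul_atTop hCpos)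
  refine squeeze_zero' (Eventually.of_forall fun N => ?_) ?_ hlim
  · exact pow_nonneg (foldedCDF_mem_Icc hv (by positivity)).1 N
  filter_upwards [eventually_ge_atTop 1] with N hN
  have hr : 0 ≤ c * √(2 * Real.log N) := by positivity
  set L := √(2 * Real.log N) with hL
  have h1 := (foldedCDF_le_one_sub (m := m) hv hr).trans (Real.one_sub_le_exp_neg _)
  refine (pow_le_pow_left₀ (foldedCDF_mem_Icc hv hr).1 h1 N).trans_eq ?_
  rw [← Real.exp_nat_mul]
  have hNL : (N : ℝ) = rexp (L ^ 2 / 2) := natCast_eq_exp_sqrt_two_mul_log_sq hN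
  simp only [Function.comp_apply, ← hL]
  rw [hNL, ← hC, mul_neg, mul_left_comm, ← Real.exp_add]
  congr 4
  push_cast
  field_simp
  ring

theorem tendsto_foldedCDF_pow_nhds_one (m : ℝ) {σ : ℝ≥0} (hσ : 0 < σ) {c : ℝ}
    (hcσ : (σ : ℝ) < c) :
    Tendsto (fun N : ℕ => foldedCDF m (σ ^ 2) (c * √(2 * Real.log N)) ^ N) atTop (nhds 1) := by
  have hv : σ ^ 2 ≠ 0 := (pow_pos hσ 2).ne'
  have hσ' : (0 : ℝ) < σ := by exact_mod_cast hσ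
  have hc : 0 < c := hσ'.trans hcσ
  have hα : 0 < c / σ - 1 := by rw [sub_pos, one_lt_div hσ']; exact hcσ
  have hlim := ((Real.tendsto_exp_neg_atTop_nhds_zero.comp
    (tendsto_mul_linear_sub_atTop hα (|m| / σ) 0)).const_mul 2).const_sub 1
  simp only [mul_zero, sub_zero] at hlim
  refine tendsto_of_tendsto_of_tendsto_of_le_of_le' hlim tendsto_const_nhds ?_
    (Eventually.of_forall fun N => pow_le_one₀ (foldedCDF_mem_Icc hv (by positivity)).1
      (foldedCDF_mem_Icc hv (by positivity)).2)
  filter_upwards [eventually_ge_atTop 1] with N hN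
  simp only [Function.comp_apply]
  have hNL := natCast_eq_exp_sqrt_two_mul_log_sq hN
  have hL0 := Real.sqrt_nonneg (2 * Real.log N)
  set L := √(2 * Real.log N) with hL
  have hr : 0 ≤ c * L := by positivity
  have hF := foldedCDF_mem_Icc (m := m) hv hr
  have h2 := one_add_mul_le_pow
    (by linarith [hF.1] : -2 ≤ foldedCDF m (σ ^ 2) (c * L) - 1) N
  rw [add_sub_cancel] at h2
  refine le_trans ?_ h2
  have h3 := mul_le_mul_of_nonneg_left
    (one_sub_foldedCDF_le (m := m) hv hr (div_nonneg hL0 hσ'.le)) (Nat.cast_nonneg (α := ℝ) N)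
  have h4 : rexp (L ^ 2 / 2) * (2 * rexp (-(L / σ) * (c * L)
      + |m| * (L / σ) + (σ ^ 2 : ℝ≥0) * (L / σ) ^ 2 / 2))
      = 2 * rexp (-(L * ((c / σ - 1) * L - |m| / σ))) := by
    rw [mul_left_comm, ← Real.exp_add]
    congr 2
    push_cast
    field_simp
    ring
  rw [← h4, ← hNL]
  linarith

/-- The spacing between the two largest absolute values of `N` independent Gaussian variables,
multiplied by `√(2 log N)`, is asymptotically exponential. -/
theorem tendsto_measureReal_pi_dominating (m : ℝ) {σ : ℝ≥0} (hσ : 0 < σ) {t : ℝ} (ht : 0 < t) :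
    Tendsto (fun N : ℕ => (Measure.pi fun _ : Fin N => gaussianReal m (σ ^ 2)).real
        {a | ∃ i, ∀ j, j ≠ i → |a j| + t / √(2 * Real.log N) ≤ |a i|})
      atTop (nhds (rexp (-t / σ))) := by
  have hv : σ ^ 2 ≠ 0 := (pow_pos hσ 2).ne'
  have hσ' : (0 : ℝ) < σ := by exact_mod_cast hσ
  have hL := tendsto_sqrt_two_mul_log_atTop
  have hLpos : ∀ᶠ N : ℕ in atTop, 0 < √(2 * Real.log N) := hL.eventually_gt_atTop 0
  have hs : Tendsto (fun N : ℕ => t / √(2 * Real.log N)) atTop (nhds 0) :=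
    tendsto_const_nhds.div_atTop hL
  have hrep : ∀ᶠ N : ℕ in atTop, ∃ n : ℕ, N = n + 1 ∧ n ≠ 0 := by
    filter_upwards [eventually_ge_atTop 2] with N hN
    exact ⟨N - 1, by omega, by omega⟩
  have hcs : ∀ c : ℝ, ∀ᶠ N : ℕ in atTop,
      rexp (-(c * √(2 * Real.log N) * (t / √(2 * Real.log N)) / (σ ^ 2 : ℝ≥0)))
        = rexp (-(c * t / (σ : ℝ) ^ 2)) := fun c => by
    filter_upwards [hLpos] with N hN
    congr 2
    push_cast
    field_simp
  have hcont : Tendsto (fun c : ℝ => rexp (-(c * t / (σ : ℝ) ^ 2))) (nhds (σ : ℝ))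
      (nhds (rexp (-t / σ))) := by
    have h : Continuous fun c : ℝ => rexp (-(c * t / (σ : ℝ) ^ 2)) := by fun_prop
    convert h.tendsto (σ : ℝ) using 3
    field_simp
  refine tendsto_order.mpr ⟨fun l hl => ?_, fun l hl => ?_⟩
  · obtain ⟨c, hlc, hc⟩ := (((hcont.mono_left nhdsWithin_le_nhds).eventually_const_lt hl).and
      (self_mem_nhdsWithin : Ioi (σ : ℝ) ∈ nhdsWithin (σ : ℝ) (Ioi (σ : ℝ)))).exists
    have hc0 : 0 < c := hσ'.trans hc
    have hlim : Tendsto (fun N : ℕ =>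
        rexp (-(|m| * (t / √(2 * Real.log N)) / (σ ^ 2 : ℝ≥0))
            - (t / √(2 * Real.log N)) ^ 2 / (2 * (σ ^ 2 : ℝ≥0)))
          * rexp (-(c * √(2 * Real.log N) * (t / √(2 * Real.log N)) / (σ ^ 2 : ℝ≥0)))
          * foldedCDF m (σ ^ 2) (c * √(2 * Real.log N)) ^ N) atTop
        (nhds (1 * rexp (-(c * t / (σ : ℝ) ^ 2)) * 1)) := by
      refine Tendsto.mul (Tendsto.mul ?_ ?_) (tendsto_foldedCDF_pow_nhds_one m hσ hc)
      · have h : Continuous fun s : ℝ =>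
            rexp (-(|m| * s / (σ ^ 2 : ℝ≥0)) - s ^ 2 / (2 * (σ ^ 2 : ℝ≥0))) := by fun_prop
        simpa [Function.comp_def] using (h.tendsto 0).comp hs
      · exact tendsto_const_nhds.congr' ((hcs c).mono fun N h => h.symm)
    rw [one_mul, mul_one] at hlim
    filter_upwards [hlim.eventually_const_lt hlc, hLpos, hrep] with N h1 h2 h3
    obtain ⟨n, rfl, hn⟩ := h3
    rw [measureReal_pi_gaussianReal_dominating hv hn (div_pos ht h2)]
    exact h1.trans_le (dominating_probability_ge hv n (div_pos ht h2).le (by positivity))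
  · obtain ⟨c, ⟨hlc, hc0⟩, hc⟩ := ((((hcont.eventually_lt_const hl).and
      (eventually_gt_nhds hσ')).filter_mono nhdsWithin_le_nhds).and
      (self_mem_nhdsWithin : Iio (σ : ℝ) ∈ nhdsWithin (σ : ℝ) (Iio (σ : ℝ)))).exists
    have hlim : Tendsto (fun N : ℕ =>
        rexp (|m| * (t / √(2 * Real.log N)) / (σ ^ 2 : ℝ≥0))
          * (foldedCDF m (σ ^ 2) (c * √(2 * Real.log N)) ^ N
            + rexp (-(c * √(2 * Real.log N) * (t / √(2 * Real.log N)) / (σ ^ 2 : ℝ≥0))))) atTop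
        (nhds (1 * (0 + rexp (-(c * t / (σ : ℝ) ^ 2))))) := by
      refine Tendsto.mul ?_ ((tendsto_foldedCDF_pow_nhds_zero m hσ hc0.le hc).add ?_)
      · have h : Continuous fun s : ℝ => rexp (|m| * s / (σ ^ 2 : ℝ≥0)) := by fun_prop
        simpa [Function.comp_def] using (h.tendsto 0).comp hs
      · exact tendsto_const_nhds.congr' ((hcs c).mono fun N h => h.symm)
    rw [one_mul, zero_add] at hlim
    filter_upwards [hlim.eventually_lt_const hlc, hLpos, hrep] with N h1 h2 h3
    obtain ⟨n, rfl, hn⟩ := h3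
    rw [measureReal_pi_gaussianReal_dominating hv hn (div_pos ht h2)]
    exact (dominating_probability_le hv n (div_pos ht h2).le (by positivity)).trans_lt h1

/-- For fixed `y ≠ 0` and `A ∈ ℝ^{1×N}` with i.i.d. `N(μ₀, σ²)` entries
(`σ > 0`), `2√(2 ln N) · stsp(y,A)` converges in distribution to an exponential random
variable with parameter `1/σ`: for every `t > 0`,
`lim_{N→∞} ℙ(2√(2 ln N) · stsp(y,A) < t) = 1 − e^{−t/σ}`. -/
theorem gaussian_condition_limit
    (lam : ℝ) (hlam : 0 < lam) (y : ℝ) (hy : y ≠ 0)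
    (μ₀ : ℝ) (σ : ℝ≥0) (hσ : 0 < σ)
    (Ω : Type) [MeasurableSpace Ω] (μ : Measure Ω) [IsProbabilityMeasure μ]
    (A : (N : ℕ) → Ω → Fin N → ℝ)
    (hmeas : ∀ N i, Measurable fun ω => A N ω i)
    (hindep : ∀ N, iIndepFun (fun i ω => A N ω i) μ)
    (hlaw : ∀ N i, Measure.map (fun ω => A N ω i) μ = gaussianReal μ₀ (σ ^ 2))
    (t : ℝ) (ht : 0 < t) :
    Tendsto
      (fun N : ℕ =>
        (μ {ω | 2 * Real.sqrt (2 * Real.log N) * stsp1 lam y (A N ω) < t}).toReal)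
      atTop (nhds (1 - Real.exp (-t / σ))) := by
  have hv : σ ^ 2 ≠ 0 := (pow_pos hσ 2).ne'
  have hmap : ∀ N, Measure.map (A N) μ = Measure.pi fun _ => gaussianReal μ₀ (σ ^ 2) := fun N => by
    have h := (iIndepFun_iff_map_fun_eq_pi_map fun i => (hmeas N i).aemeasurable).mp (hindep N)
    simpa only [hlaw] using h
  have hAmeas : ∀ N, Measurable (A N) := fun N => measurable_pi_iff.mpr (hmeas N)
  set K : ℝ := lam / |y| + 1 with hK
  have hK0 : 0 ≤ K := by positivity
  set D : ℕ → Set Ω := fun N =>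
    {ω | ∃ i, ∀ j, j ≠ i → |A N ω j| + t / √(2 * Real.log N) ≤ |A N ω i|} with hD
  set S : ℕ → Set Ω := fun N => {ω | ∀ i, |A N ω i| ≤ K} with hS
  have hDmeas : ∀ N, MeasurableSet (D N) := fun N =>
    hAmeas N (measurableSet_exists_dominating N (t / √(2 * Real.log N)))
  have hDlim : Tendsto (fun N => μ.real (D N)ᶜ) atTop (nhds (1 - rexp (-t / σ))) := by
    refine ((tendsto_measureReal_pi_dominating μ₀ hσ ht).const_sub 1).congr fun N => ?_
    rw [probReal_compl_eq_one_sub (hDmeas N), ← hmap,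
      map_measureReal_apply (hAmeas N) (measurableSet_exists_dominating N _)]
    rfl
  have hSlim : Tendsto (fun N => μ.real (S N)) atTop (nhds 0) := by
    have h := tendsto_pow_atTop_nhds_zero_of_lt_one (foldedCDF_mem_Icc (m := μ₀) hv hK0).1
      (foldedCDF_lt_one (m := μ₀) hv hK0)
    refine h.congr fun N => ?_
    have hset : S N = A N ⁻¹' (Set.univ.pi fun _ => {z | |z| ≤ K}) := by
      ext; simp [hS]
    have hmeasK : MeasurableSet (Set.univ.pi fun _ : Fin N => {z : ℝ | |z| ≤ K}) :=
      MeasurableSet.univ_pi fun _ => measurableSet_le measurable_norm measurable_const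
    rw [hset, ← map_measureReal_apply (hAmeas N) hmeasK, hmap, measureReal_def, Measure.pi_pi,
      ← measureReal_abs_le hv hK0]
    simp [measureReal_def]
  have hkey : ∀ᶠ N : ℕ in atTop, ∀ ω ∉ S N,
      2 * √(2 * Real.log N) * stsp1 lam y (A N ω) < t ↔ ω ∈ (D N)ᶜ := by
    have hL := tendsto_sqrt_two_mul_log_atTop
    have hδ : Tendsto (fun N : ℕ => t / (2 * √(2 * Real.log N))) atTop (nhds 0) :=
      tendsto_const_nhds.div_atTop (hL.const_mul_atTop two_pos)
    have hy2 : 0 < |y| / 2 := by positivity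
    filter_upwards [hL.eventually_gt_atTop 0, hδ.eventually_le_const one_pos,
      hδ.eventually_le_const hy2] with N hN h1 h2 ω hω
    simp only [hS, Set.mem_ofPred_eq, not_forall, not_le] at hω
    have h := le_stsp1_iff hlam hy hK.symm.le (by positivity) h1 h2 (A N ω) hω
    have e : 2 * (t / (2 * √(2 * Real.log N))) = t / √(2 * Real.log N) := by field_simp
    rw [e] at h
    rw [Set.mem_compl_iff]
    simp only [hD, Set.mem_ofPred_eq]
    rw [← h, not_le, lt_div_iff₀' (by positivity)]
  refine tendsto_of_tendsto_of_tendsto_of_le_of_le'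
    (by simpa using hDlim.sub hSlim) (by simpa using hDlim.add hSlim) ?_ ?_
  · filter_upwards [hkey] with N hN
    rw [sub_le_iff_le_add]
    refine (measureReal_mono fun ω hω => ?_).trans (measureReal_union_le _ _)
    by_cases hωS : ω ∈ S N
    · exact Or.inr hωS
    · exact Or.inl ((hN ω hωS).mpr hω)
  · filter_upwards [hkey] with N hN
    refine (measureReal_mono fun ω hω => ?_).trans (measureReal_union_le _ _)
    by_cases hωS : ω ∈ S N
    · exact Or.inr hωS
    · exact Or.inl ((hN ω hωS).mp hω)
end
end

section
/- Let F be the cumulative distribution function of a non-negative real random variable X whose law is absolutely continuous with respect to the Lebesgue measure on ℝ, and let c > 0 be such that F(c) < 1. For each N, let A^{(N)} ∈ ℝ^N be a random vector with i.i.d. entries such that |A^{(N)}_i| is distributed as X. Let y ∈ ℝ and let (b_N)_{N≥1} be a sequence of non-negative reals such that, for all sufficiently large N, b_N < |y| and λ/(2|y| − 2b_N) + b_N ≤ c. Then lim_{N→∞} ℙ(Z(y, A^{(N)}, b_N)) = 1. -/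
open MeasureTheory ProbabilityTheory Filter Real Set
open scoped ENNReal NNReal

noncomputable section

/-- The event `Z(y,A,ε)`: every `ε`-perturbation `(ỹ,Ã)` of `(y,A)` (in the max norm)
has `0 ∉ Sol(ỹ,Ã)`. -/
def Zevent {N : ℕ} (lam : ℝ) (y : ℝ) (A : Fin N → ℝ) (ε : ℝ) : Prop :=
  ∀ (y' : ℝ) (A' : Fin N → ℝ), |y' - y| ≤ ε → (∀ j, |A' j - A j| ≤ ε) →
    (0 : Fin N → ℝ) ∉ Sol1 lam y' A'

/-- `δ(A)`: the largest entry of `(|A₁|,…,|A_N|)` minus the second largest entry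
(the second largest being `min_i max_{j ≠ i} |A_j|`). -/
def gap {N : ℕ} (A : Fin N → ℝ) : ℝ :=
  sSup (Set.range fun i => |A i|) -
    sInf (Set.range fun i : Fin N => sSup {v | ∃ j, j ≠ i ∧ v = |A j|})

/-- If some column correlates with the data beyond `lam / 2`, then `0` does not solve the LASSO. -/
theorem zero_notMem_Sol1 {N : ℕ} {lam y : ℝ} {A : Fin N → ℝ} (i : Fin N)
    (h0 : 0 ≤ lam) (h : lam < 2 * (|A i| * |y|)) : (0 : Fin N → ℝ) ∉ Sol1 lam y A := by
  intro hsol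
  have key : ∀ s : ℝ, y ^ 2 ≤ (A i * s - y) ^ 2 + lam * |s| := by
    intro s
    have hs := hsol (Pi.single i s)
    have habs : ∑ j, |(Pi.single i s : Fin N → ℝ) j| = |s| := by
      rw [Finset.sum_eq_single i]
      · simp
      · intro j _ hj
        simp [Pi.single_eq_of_ne hj]
      · simp
    simpa [lassoObj, habs, Matrix.mulVec_single] using hs
  have hw : 0 < |A i * y| := by rw [abs_mul]; linarith
  have hA : A i ≠ 0 := by
    intro hzero
    simp [hzero] at hw
  rw [← abs_mul] at h
  obtain ⟨w, hwdef⟩ : ∃ w, w = A i * y := ⟨_, rfl⟩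
  rw [← hwdef] at hw h
  have hwsq : |w| ^ 2 = w ^ 2 := sq_abs w
  obtain ⟨t, ht, hbd⟩ : ∃ t > 0, A i ^ 2 * |w| * t < 2 * |w| - lam := by
    refine ⟨(2 * |w| - lam) / (2 * (A i ^ 2 * |w|)), by apply div_pos <;> [linarith; positivity], ?_⟩
    have : A i ^ 2 * |w| * ((2 * |w| - lam) / (2 * (A i ^ 2 * |w|))) = (2 * |w| - lam) / 2 := by
      field_simp
    linarith
  have hk := key (w * t)
  rw [abs_mul, abs_of_pos ht] at hk
  have hexp : (A i * (w * t) - y) ^ 2 + lam * (|w| * t) - y ^ 2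
      = |w| * t * (A i ^ 2 * |w| * t - (2 * |w| - lam)) := by
    linear_combination (2 * t - A i ^ 2 * t ^ 2) * hwsq + 2 * w * t * hwdef
  have hneg := mul_neg_of_pos_of_neg (mul_pos hw ht) (sub_neg.2 hbd)
  linarith

/-- One entry of modulus greater than `c` makes every `b`-perturbation have nonzero solutions. -/
theorem Zevent_of_lt_abs {N : ℕ} {lam y b c : ℝ} {A : Fin N → ℝ} (i : Fin N)
    (h0 : 0 ≤ lam) (hb : b < |y|) (hc : lam / (2 * |y| - 2 * b) + b ≤ c) (hA : c < |A i|) :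
    Zevent lam y A b := by
  intro y' A' hy' hA'
  refine zero_notMem_Sol1 i h0 ?_
  have hden : 0 < 2 * |y| - 2 * b := by linarith
  have hy : |y| - b ≤ |y'| := by
    have := abs_sub_abs_le_abs_sub y y'
    rw [abs_sub_comm] at this
    linarith
  have hAi : lam / (2 * |y| - 2 * b) < |A' i| := by
    have := abs_sub_abs_le_abs_sub (A i) (A' i)
    rw [abs_sub_comm] at this
    linarith [hA' i]
  rw [div_lt_iff₀ hden] at hAi
  nlinarith [mul_le_mul_of_nonneg_left hy (abs_nonneg (A' i))]

/-- The probability that i.i.d. variables all have modulus at most `c` is the power `F(c)^N`. -/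
theorem measure_forall_abs_le {Ω : Type*} [MeasurableSpace Ω] {μ : Measure Ω} {ν : Measure ℝ}
    {N : ℕ} {X : Fin N → Ω → ℝ} (hmeas : ∀ i, Measurable (X i)) (hindep : iIndepFun X μ)
    (hlaw : ∀ i, Measure.map (fun ω => |X i ω|) μ = ν) (c : ℝ) :
    μ {ω | ∀ i, |X i ω| ≤ c} = ν (Set.Iic c) ^ N := by
  have hset : {ω | ∀ i, |X i ω| ≤ c}
      = ⋂ i ∈ (Finset.univ : Finset (Fin N)), X i ⁻¹' {x | |x| ≤ c} := by
    ext ω; simp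
  rw [hset, hindep.measure_inter_preimage_eq_mul Finset.univ
    (sets := fun _ => {x | |x| ≤ c})
    fun _ _ => measurableSet_le measurable_norm measurable_const]
  have hi : ∀ i, μ (X i ⁻¹' {x | |x| ≤ c}) = ν (Set.Iic c) := fun i => by
    rw [← hlaw i, Measure.map_apply (hmeas i).abs measurableSet_Iic]
    rfl
  rw [Finset.prod_congr rfl fun i _ => hi i, Finset.prod_const, Finset.card_univ, Fintype.card_fin]

/-- Let `F` be the CDF of a non-negative random variable `X` (with law `ν`)
absolutely continuous w.r.t. Lebesgue measure, and `c > 0` with `F(c) < 1`. If the entries of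
`A^{(N)} ∈ ℝ^N` are i.i.d. with `|A^{(N)}_i|` distributed as `X`, and `(b_N)` are non-negative
reals with `b_N < |y|` and `λ/(2|y| − 2b_N) + b_N ≤ c` for all sufficiently large `N`, then
`lim_{N→∞} ℙ(Z(y, A^{(N)}, b_N)) = 1`. -/
theorem Z_limit_general
    (lam : ℝ) (hlam : 0 < lam) (y : ℝ)
    (ν : Measure ℝ) [IsProbabilityMeasure ν] (hac : ν ≪ (volume : Measure ℝ))
    (hnonneg : ν (Set.Iio (0 : ℝ)) = 0)
    (c : ℝ) (hc : 0 < c) (hFc : (ν (Set.Iic c)).toReal < 1)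
    (Ω : Type) [MeasurableSpace Ω] (μ : Measure Ω) [IsProbabilityMeasure μ]
    (A : (N : ℕ) → Ω → Fin N → ℝ)
    (hmeas : ∀ N i, Measurable fun ω => A N ω i)
    (hindep : ∀ N, iIndepFun (fun i ω => A N ω i) μ)
    (hlaw : ∀ N i, Measure.map (fun ω => |A N ω i|) μ = ν)
    (b : ℕ → ℝ) (hb : ∀ N, 0 ≤ b N)
    (hbc : ∀ᶠ N : ℕ in atTop, b N < |y| ∧ lam / (2 * |y| - 2 * b N) + b N ≤ c) :
    Tendsto (fun N : ℕ => (μ {ω | Zevent lam y (A N ω) (b N)}).toReal) atTop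
      (nhds 1) := by
  have hle : ∀ N, (μ {ω | Zevent lam y (A N ω) (b N)}).toReal ≤ 1 := fun N =>
    measureReal_le_one
  have hlow : ∀ᶠ N : ℕ in atTop, 1 - (ν (Set.Iic c)).toReal ^ N
      ≤ (μ {ω | Zevent lam y (A N ω) (b N)}).toReal := by
    filter_upwards [hbc] with N hN
    have hS : MeasurableSet {ω | ∀ i, |A N ω i| ≤ c} := by
      rw [Set.ofPred_forall]
      exact MeasurableSet.iInter fun i => measurableSet_le (hmeas N i).abs measurable_const
    have hsub : {ω | ∀ i, |A N ω i| ≤ c}ᶜ ⊆ {ω | Zevent lam y (A N ω) (b N)} := by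
      intro ω hω
      simp only [Set.mem_compl_iff, Set.mem_ofPred_eq, not_forall, not_le] at hω
      obtain ⟨i, hi⟩ := hω
      exact Zevent_of_lt_abs i hlam.le hN.1 hN.2 hi
    have hcompl := probReal_compl_eq_one_sub (μ := μ) hS
    rw [measureReal_def μ {ω | ∀ i, |A N ω i| ≤ c},
      measure_forall_abs_le (hmeas N) (hindep N) (hlaw N) c, ENNReal.toReal_pow] at hcompl
    rw [← hcompl]
    exact measureReal_mono hsub
  have hlim : Tendsto (fun N : ℕ => 1 - (ν (Set.Iic c)).toReal ^ N) atTop (nhds 1) := by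
    simpa using (tendsto_pow_atTop_nhds_zero_of_lt_one ENNReal.toReal_nonneg hFc).const_sub 1
  exact tendsto_of_tendsto_of_tendsto_of_le_of_le' hlim tendsto_const_nhds hlow
    (Eventually.of_forall hle)
end
end

section
/- Let y ∈ ℝ, b > 0, and for each N let A ∈ ℝ^N be a random vector whose entries are i.i.d. exponentially distributed with parameter 1. If b < |y| then lim_{N→∞} ℙ(Z(y,A,b)) = 1, whereas if b ≥ |y| then ℙ(Z(y,A,b)) = 0 for every N (in particular lim_{N→∞} ℙ(Z(y,A,b)) = 0). -/
open MeasureTheory ProbabilityTheory Filter Real Set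
open scoped ENNReal NNReal

noncomputable section

/-- A single column that correlates strongly enough with the data excludes the zero solution. -/
lemma zero_notMem_Sol1_of_lt {N : ℕ} {lam y : ℝ} {A : Fin N → ℝ} {j : Fin N}
    (hlam : 0 < lam) (h : lam < 2 * |y| * A j) : (0 : Fin N → ℝ) ∉ Sol1 lam y A := by
  intro h0
  have hA : 0 < A j := by
    by_contra! hA
    nlinarith [abs_nonneg y]
  set d := 2 * |y| * A j - lam with hd
  have hd0 : 0 < d := sub_pos.2 h
  set t := d / (2 * A j ^ 2) with ht
  have ht0 : 0 < t := by positivity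
  have hta : 2 * A j ^ 2 * t = d := by rw [ht]; field_simp
  obtain ⟨s, hs, hsy⟩ : ∃ s : ℝ, |s| = 1 ∧ s * y = |y| := by
    rcases le_total 0 y with hy | hy
    · exact ⟨1, by simp, by simp [abs_of_nonneg hy]⟩
    · exact ⟨-1, by simp, by simp [abs_of_nonpos hy]⟩
  have hs2 : s ^ 2 = 1 := by rw [← sq_abs, hs, one_pow]
  have hz := h0 (Pi.single j (s * t))
  have hsum : ∑ k, |(Pi.single j (s * t) : Fin N → ℝ) k| = t := by
    rw [Finset.sum_eq_single j]
    · simp [abs_mul, hs, abs_of_pos ht0]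
    · intro k _ hk
      simp [hk]
    · simp
  simp only [lassoObj, Matrix.mulVec_zero, Matrix.mulVec_single, hsum] at hz
  simp at hz
  have hexpand : (A j * (s * t) - y) ^ 2 + lam * t = y ^ 2 - d * t / 2 := by
    linear_combination (A j ^ 2 * t ^ 2) * hs2 - 2 * A j * t * hsy + t / 2 * hta - t * hd
  linarith [mul_pos hd0 ht0]

/-- A single large entry of `A` forces the event `Z(y,A,b)` when `b < |y|`. -/
lemma Zevent_of_lt {N : ℕ} {lam y b : ℝ} {A : Fin N → ℝ} {j : Fin N}
    (hlam : 0 < lam) (hy : b < |y|) (hA : b + lam / (2 * (|y| - b)) < A j) :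
    Zevent lam y A b := by
  intro y' A' hy' hA'
  have hyb : 0 < |y| - b := sub_pos.2 hy
  have h1 : |y| - b ≤ |y'| := by
    have := abs_sub_abs_le_abs_sub y y'
    rw [abs_sub_comm] at this
    linarith
  have h2 : lam / (2 * (|y| - b)) < A' j := by
    have := (abs_le.1 (hA' j)).1
    linarith
  have h3 : 0 < A' j := lt_trans (by positivity) h2
  refine zero_notMem_Sol1_of_lt (j := j) hlam ?_
  rw [div_lt_iff₀ (by positivity)] at h2
  nlinarith

/-- The zero vector solves the LASSO problem with zero data. -/
lemma zero_mem_Sol1_zero {N : ℕ} {lam : ℝ} (hlam : 0 < lam) (A : Fin N → ℝ) :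
    (0 : Fin N → ℝ) ∈ Sol1 lam 0 A := by
  intro z
  have h : 0 ≤ lassoObj lam (fun _ : Fin 1 => 0) (Matrix.of fun _ j => A j) z := by
    unfold lassoObj
    positivity
  simpa [lassoObj] using h

/-- The probability that `N` independent exponential variables are all at most `c`. -/
lemma measureReal_forall_le_of_exp {Ω : Type*} [MeasurableSpace Ω] {μ : Measure Ω} {N : ℕ}
    {X : Fin N → Ω → ℝ} (hmeas : ∀ i, Measurable (X i)) (hindep : iIndepFun X μ)
    (hlaw : ∀ i, μ.map (X i) = expMeasure 1) {c : ℝ} (hc : 0 ≤ c) :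
    μ.real {ω | ∀ i, X i ω ≤ c} = (1 - exp (-c)) ^ N := by
  have hone : ∀ i, μ.real (X i ⁻¹' Iic c) = 1 - exp (-c) := by
    intro i
    have := isProbabilityMeasure_expMeasure one_pos
    rw [← map_measureReal_apply (hmeas i) measurableSet_Iic, hlaw i, ← cdf_eq_real,
      cdf_expMeasure_eq one_pos, if_pos hc, one_mul]
  have hset : {ω | ∀ i, X i ω ≤ c} = ⋂ i, X i ⁻¹' Iic c := by
    ext ω
    simp
  rw [hset, measureReal_def, hindep.meas_iInter fun i => ⟨Iic c, measurableSet_Iic, rfl⟩,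
    ENNReal.toReal_prod]
  simp [← measureReal_def, hone]

/-- For `y ∈ ℝ`, `b > 0` and `A ∈ ℝ^N` with i.i.d. entries exponentially
distributed with parameter `1`: if `b < |y|` then `lim_{N→∞} ℙ(Z(y,A,b)) = 1`, whereas if
`b ≥ |y|` then `ℙ(Z(y,A,b)) = 0` for every `N`. -/
theorem Z_limit_exponential
    (lam : ℝ) (hlam : 0 < lam) (y : ℝ) (b : ℝ) (hb : 0 < b)
    (Ω : Type) [MeasurableSpace Ω] (μ : Measure Ω) [IsProbabilityMeasure μ]
    (A : (N : ℕ) → Ω → Fin N → ℝ)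
    (hmeas : ∀ N i, Measurable fun ω => A N ω i)
    (hindep : ∀ N, iIndepFun (fun i ω => A N ω i) μ)
    (hlaw : ∀ N i, Measure.map (fun ω => A N ω i) μ = expMeasure 1) :
    (b < |y| →
      Tendsto (fun N : ℕ => (μ {ω | Zevent lam y (A N ω) b}).toReal) atTop (nhds 1)) ∧
    (|y| ≤ b → ∀ N : ℕ, μ {ω | Zevent lam y (A N ω) b} = 0) := by
  refine ⟨fun hy => ?_, fun hy N => ?_⟩
  · set c := b + lam / (2 * (|y| - b)) with hc_def
    have hyb : 0 < |y| - b := sub_pos.2 hy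
    have hc : 0 < c := by positivity
    have hlower : ∀ N, 1 - (1 - exp (-c)) ^ N ≤ (μ {ω | Zevent lam y (A N ω) b}).toReal := by
      intro N
      have hms : MeasurableSet {ω | ∀ i, A N ω i ≤ c} := by
        simp only [ofPred_forall]
        exact MeasurableSet.iInter fun i => measurableSet_le (hmeas N i) measurable_const
      rw [← measureReal_forall_le_of_exp (hmeas N) (hindep N) (hlaw N) hc.le,
        ← probReal_compl_eq_one_sub hms, ← measureReal_def]
      refine measureReal_mono fun ω hω => ?_
      simp only [mem_compl_iff, mem_ofPred_eq, not_forall, not_le] at hω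
      obtain ⟨j, hj⟩ := hω
      exact Zevent_of_lt hlam hy hj
    have hlim : Tendsto (fun N : ℕ => 1 - (1 - exp (-c)) ^ N) atTop (nhds 1) := by
      have h1 : exp (-c) ≤ 1 := exp_le_one_iff.2 (by linarith)
      simpa using (tendsto_pow_atTop_nhds_zero_of_lt_one (sub_nonneg.2 h1)
        (sub_lt_self 1 (exp_pos (-c)))).const_sub 1
    exact tendsto_of_tendsto_of_tendsto_of_le_of_le hlim tendsto_const_nhds hlower
      fun N => measureReal_le_one
  · have hempty : {ω | Zevent lam y (A N ω) b} = ∅ := by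
      ext ω
      simp only [mem_ofPred_eq, mem_empty_iff_false, iff_false]
      exact fun h => h 0 (A N ω) (by simpa using hy) (fun j => by simpa using hb.le)
        (zero_mem_Sol1_zero hlam _)
    rw [hempty, measure_empty]
end
end

section
/- For each N ≥ 2 let A ∈ ℝ^N be a random vector with i.i.d. entries, each normally distributed N(μ, σ²) with σ > 0. Then for every t > 0, lim_{N→∞} ℙ(δ(A) > tσ/√(2 ln N)) = e^{−t}. -/
open MeasureTheory ProbabilityTheory Filter Real Set
open scoped ENNReal NNReal

noncomputable section

/-! ### The gap event -/

theorem lt_gap_iff {N : ℕ} [Nontrivial (Fin N)] (A : Fin N → ℝ) {a : ℝ} (ha : 0 ≤ a) :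
    a < gap A ↔ ∃ i, ∀ j, j ≠ i → |A j| + a < |A i| := by
  have hmax : ∀ i, sSup {v | ∃ j, j ≠ i ∧ v = |A j|} ∈ {v | ∃ j, j ≠ i ∧ v = |A j|} ∧
      ∀ j, j ≠ i → |A j| ≤ sSup {v | ∃ j, j ≠ i ∧ v = |A j|} := by
    intro i
    have hfin : {v | ∃ j, j ≠ i ∧ v = |A j|}.Finite :=
      (Set.finite_range fun j => |A j|).subset (by rintro _ ⟨j, -, rfl⟩; exact ⟨j, rfl⟩)
    obtain ⟨k, hk⟩ := exists_ne i
    exact ⟨Set.Nonempty.csSup_mem ⟨_, k, hk, rfl⟩ hfin,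
      fun j hj => le_csSup hfin.bddAbove ⟨j, hj, rfl⟩⟩
  have hfin := Set.finite_range fun i => |A i|
  have hle : ∀ i, |A i| ≤ sSup (Set.range fun i => |A i|) :=
    fun i => le_csSup hfin.bddAbove ⟨i, rfl⟩
  have hinf : a < gap A ↔ ∃ i, sSup {v | ∃ j, j ≠ i ∧ v = |A j|} <
      sSup (Set.range fun i => |A i|) - a := by
    rw [gap, lt_sub_comm, csInf_lt_iff (Set.finite_range _).bddBelow (Set.range_nonempty _)]
    simp
  rw [hinf]
  refine exists_congr fun i => ⟨fun h => ?_, fun h => ?_⟩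
  · obtain ⟨k, hk⟩ := Set.Nonempty.csSup_mem (Set.range_nonempty fun i => |A i|) hfin
    simp only at hk
    have hki : k = i := by
      by_contra hne
      have := (hmax i).2 k hne
      linarith
    subst hki
    intro j hj
    have := (hmax k).2 j hj
    linarith
  · obtain ⟨j, hj, hjv⟩ := (hmax i).1
    have := h j hj
    have := hle i
    linarith

/-- `absCdf γ r` is the `γ`-mass of `(-r, r)`. -/
def absCdf (γ : Measure ℝ) (r : ℝ) : ℝ≥0∞ := γ {y | |y| < r}

theorem absCdf_mono (γ : Measure ℝ) : Monotone (absCdf γ) :=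
  fun _ _ h => measure_mono fun _ hy => lt_of_lt_of_le hy h

theorem measurable_absCdf (γ : Measure ℝ) : Measurable (absCdf γ) :=
  (absCdf_mono γ).measurable

theorem absCdf_of_nonpos (γ : Measure ℝ) {r : ℝ} (hr : r ≤ 0) : absCdf γ r = 0 := by
  have : {y : ℝ | |y| < r} = ∅ := by
    ext y
    simpa using hr.trans (abs_nonneg y)
  rw [absCdf, this, measure_empty]

theorem absCdf_le_one (γ : Measure ℝ) [IsProbabilityMeasure γ] (r : ℝ) : absCdf γ r ≤ 1 :=
  prob_le_one

theorem measure_abs_le_eq_absCdf (γ : Measure ℝ) [NullSingletonClass γ] (r : ℝ) :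
    γ {y | |y| ≤ r} = absCdf γ r := by
  refine le_antisymm ?_ (measure_mono fun y (hy : |y| < r) => hy.le)
  have hsub : {y : ℝ | |y| ≤ r} ⊆ {y | |y| < r} ∪ {r, -r} := by
    intro y hy
    rcases lt_or_eq_of_le (show |y| ≤ r from hy) with h | h
    · exact Or.inl h
    · exact Or.inr (eq_or_eq_neg_of_abs_eq h)
  refine (measure_mono hsub).trans ((measure_union_le _ _).trans ?_)
  rw [((Set.finite_singleton (-r)).insert r).measure_zero γ, add_zero, absCdf]

/-- Under a product measure, the probability that the `i`-th coordinate is related to all other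
coordinates. -/
theorem pi_forall_rel (γ : Measure ℝ) [IsProbabilityMeasure γ] {n : ℕ} (i : Fin (n + 1))
    {S : Set (ℝ × ℝ)} (hS : MeasurableSet S) :
    Measure.pi (fun _ : Fin (n + 1) => γ) {z | ∀ j, j ≠ i → (z i, z j) ∈ S} =
      ∫⁻ x, γ {y | (x, y) ∈ S} ^ n ∂γ := by
  have hT : MeasurableSet {p : ℝ × (Fin n → ℝ) | ∀ j, (p.1, p.2 j) ∈ S} := by
    rw [Set.ofPred_forall]
    exact MeasurableSet.iInter fun j =>
      hS.preimage (measurable_fst.prodMk ((measurable_pi_apply j).comp measurable_snd))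
  have hpre : {z : Fin (n + 1) → ℝ | ∀ j, j ≠ i → (z i, z j) ∈ S} =
      MeasurableEquiv.piFinSuccAbove (fun _ => ℝ) i ⁻¹'
        {p : ℝ × (Fin n → ℝ) | ∀ j, (p.1, p.2 j) ∈ S} := by
    ext z
    simp [i.forall_iff_succAbove, Fin.succAbove_ne, Fin.removeNth]
  rw [hpre, (measurePreserving_piFinSuccAbove (fun _ => γ) i).measure_preimage
    hT.nullMeasurableSet, Measure.prod_apply hT]
  refine lintegral_congr fun x => ?_
  have : Prod.mk x ⁻¹' {p : ℝ × (Fin n → ℝ) | ∀ j, (p.1, p.2 j) ∈ S} =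
      Set.univ.pi fun _ => {y | (x, y) ∈ S} := by
    ext; simp
  rw [this, Measure.pi_pi]
  simp

theorem pi_abs_add_lt (γ : Measure ℝ) [IsProbabilityMeasure γ] {n : ℕ} (i : Fin (n + 1)) (a : ℝ) :
    Measure.pi (fun _ : Fin (n + 1) => γ) {z | ∀ j, j ≠ i → |z j| + a < |z i|} =
      ∫⁻ x, absCdf γ (|x| - a) ^ n ∂γ := by
  have h := pi_forall_rel γ i (S := {p | |p.2| + a < |p.1|})
    (measurableSet_lt (by fun_prop) (by fun_prop))
  simpa [absCdf, lt_sub_iff_add_lt] using h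

/-- The events that the `i`-th coordinate exceeds all others by more than `a` are disjoint, so
their probabilities add up. -/
theorem pi_exists_abs_add_lt (γ : Measure ℝ) [IsProbabilityMeasure γ] (n : ℕ) {a : ℝ}
    (ha : 0 ≤ a) :
    Measure.pi (fun _ : Fin (n + 1) => γ) {z | ∃ i, ∀ j, j ≠ i → |z j| + a < |z i|} =
      (n + 1) * ∫⁻ x, absCdf γ (|x| - a) ^ n ∂γ := by
  rw [Set.ofPred_exists, measure_iUnion]
  · simp [pi_abs_add_lt]
  · intro i k hik
    rw [Function.onFun, Set.disjoint_left]
    intro z hi hk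
    have h₁ := hi k hik.symm
    have h₂ := hk i hik
    linarith
  · intro i
    simp only [Set.ofPred_forall]
    exact MeasurableSet.iInter fun j => MeasurableSet.iInter fun _ =>
      measurableSet_lt (by fun_prop) (by fun_prop)

theorem mul_lintegral_absCdf_pow_le_one (γ : Measure ℝ) [IsProbabilityMeasure γ] (n : ℕ) :
    (n + 1) * ∫⁻ x, absCdf γ |x| ^ n ∂γ ≤ 1 := by
  have h := pi_exists_abs_add_lt γ n le_rfl
  simp only [sub_zero] at h
  exact h ▸ prob_le_one

theorem one_le_mul_lintegral_absCdf_pow (γ : Measure ℝ) [IsProbabilityMeasure γ]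
    [NullSingletonClass γ] (n : ℕ) :
    1 ≤ (n + 1) * ∫⁻ x, absCdf γ |x| ^ n ∂γ := by
  have h : ∀ i : Fin (n + 1), Measure.pi (fun _ : Fin (n + 1) => γ)
      {z | ∀ j, j ≠ i → |z j| ≤ |z i|} = ∫⁻ x, absCdf γ |x| ^ n ∂γ := by
    intro i
    have h := pi_forall_rel γ i (S := {p | |p.2| ≤ |p.1|})
      (measurableSet_le (by fun_prop) (by fun_prop))
    simpa [measure_abs_le_eq_absCdf] using h
  have hcover : (Set.univ : Set (Fin (n + 1) → ℝ)) =
      ⋃ i, {z | ∀ j, j ≠ i → |z j| ≤ |z i|} := by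
    refine (Set.eq_univ_of_forall fun z => ?_).symm
    obtain ⟨i, hi⟩ := Finite.exists_max fun i => |z i|
    exact Set.mem_iUnion.2 ⟨i, fun j _ => hi j⟩
  calc (1 : ℝ≥0∞) = Measure.pi (fun _ : Fin (n + 1) => γ) Set.univ := measure_univ.symm
    _ ≤ ∑' i : Fin (n + 1), ∫⁻ x, absCdf γ |x| ^ n ∂γ := by
      rw [hcover]
      exact (measure_iUnion_le _).trans (ENNReal.tsum_le_tsum fun i => (h i).le)
    _ = (n + 1) * ∫⁻ x, absCdf γ |x| ^ n ∂γ := by simp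

theorem measure_lt_gap {Ω : Type*} [MeasurableSpace Ω] {μ : Measure Ω}
    [IsProbabilityMeasure μ] {γ : Measure ℝ} [IsProbabilityMeasure γ] {n : ℕ}
    {A : Ω → Fin (n + 2) → ℝ} (hmeas : ∀ i, Measurable fun ω => A ω i)
    (hindep : iIndepFun (fun i ω => A ω i) μ)
    (hlaw : ∀ i, Measure.map (fun ω => A ω i) μ = γ) {a : ℝ} (ha : 0 ≤ a) :
    μ {ω | a < gap (A ω)} = (n + 2) * ∫⁻ x, absCdf γ (|x| - a) ^ (n + 1) ∂γ := by
  have hmap : Measure.map A μ = Measure.pi fun _ => γ := by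
    have := (iIndepFun_iff_map_fun_eq_pi_map fun i => (hmeas i).aemeasurable).1 hindep
    simpa only [hlaw] using this
  have hmeasSet : MeasurableSet
      {z : Fin (n + 2) → ℝ | ∃ i, ∀ j, j ≠ i → |z j| + a < |z i|} := by
    simp only [Set.ofPred_exists, Set.ofPred_forall]
    exact MeasurableSet.iUnion fun i => MeasurableSet.iInter fun j => MeasurableSet.iInter fun _ =>
      measurableSet_lt (by fun_prop) (by fun_prop)
  have h := pi_exists_abs_add_lt γ (n + 1) ha
  rw [← hmap, Measure.map_apply (measurable_pi_iff.2 hmeas) hmeasSet] at h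
  simp only [lt_gap_iff _ ha]
  rw [Set.preimage_ofPred_eq] at h
  rw [h]
  push_cast
  ring

/-! ### Shifting the absolute value in a Gaussian integral -/

theorem lintegral_abs_sub_mul {φ : ℝ → ℝ≥0∞} (p : ℝ → ℝ≥0∞)
    (hφ₀ : ∀ r ≤ 0, φ r = 0) {a : ℝ} (ha : 0 ≤ a) :
    ∫⁻ x, φ (|x| - a) * p x = ∫⁻ w, φ |w| * if 0 < w then p (w + a) else p (w - a) := by
  have hpos : ∫⁻ x in Set.Ioi 0, φ (|x| - a) * p x = ∫⁻ w in Set.Ioi 0, φ |w| * p (w + a) := by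
    rw [← lintegral_indicator measurableSet_Ioi, ← lintegral_indicator measurableSet_Ioi,
      ← lintegral_add_right_eq_self _ a]
    refine lintegral_congr fun w => ?_
    by_cases hw : 0 < w
    · have hwa : 0 < w + a := by linarith
      simp [Set.indicator, hw, hwa, abs_of_pos]
    · have hz : φ w = 0 := hφ₀ _ (not_lt.1 hw)
      by_cases hwa : 0 < w + a
      · simp [Set.indicator, hw, hwa, abs_of_pos, hz]
      · simp [Set.indicator, hw, hwa]
  have hneg : ∫⁻ x in (Set.Ioi 0)ᶜ, φ (|x| - a) * p x =
      ∫⁻ w in (Set.Ioi 0)ᶜ, φ |w| * p (w - a) := by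
    rw [← lintegral_indicator measurableSet_Ioi.compl,
      ← lintegral_indicator measurableSet_Ioi.compl, ← lintegral_sub_right_eq_self _ a]
    refine lintegral_congr fun w => ?_
    by_cases hw : w ≤ 0
    · have hwa : w ≤ a := by linarith
      have habs : |w - a| - a = |w| := by
        rw [abs_of_nonpos hw, abs_of_nonpos (by linarith)]; ring
      simp [Set.indicator, hw, hwa, habs]
    · by_cases hwa : w ≤ a
      · have hz : φ (|w - a| - a) = 0 := by
          rw [abs_of_nonpos (by linarith)]; exact hφ₀ _ (by linarith)
        simp [Set.indicator, hw, hwa, hz]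
      · simp [Set.indicator, hw, hwa]
  rw [← lintegral_add_compl _ (measurableSet_Ioi (a := (0 : ℝ))), hpos, hneg,
    ← lintegral_add_compl (fun w => φ |w| * if 0 < w then p (w + a) else p (w - a))
      (measurableSet_Ioi (a := (0 : ℝ)))]
  congr 1
  · exact setLIntegral_congr_fun measurableSet_Ioi fun w (hw : 0 < w) => by simp [hw]
  · exact setLIntegral_congr_fun measurableSet_Ioi.compl fun w hw => by
      have : ¬ 0 < w := hw
      simp [this]

theorem gaussianPDFReal_add_eq_exp_mul (m : ℝ) {v : ℝ≥0} (hv : v ≠ 0) {a e w : ℝ}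
    (he : e ^ 2 = a ^ 2) (hew : e * w = a * |w|) :
    gaussianPDFReal m v (w + e) =
      Real.exp (e * m / v - a ^ 2 / (2 * v)) * (Real.exp (-(a / v) * |w|) *
        gaussianPDFReal m v w) := by
  have hv' : (v : ℝ) ≠ 0 := by exact_mod_cast hv
  have hexp : -(w + e - m) ^ 2 / (2 * v) =
      (e * m / v - a ^ 2 / (2 * v)) + (-(a / v) * |w|) + -(w - m) ^ 2 / (2 * v) := by
    field_simp
    linear_combination -he - 2 * hew
  rw [gaussianPDFReal, gaussianPDFReal, hexp, Real.exp_add, Real.exp_add]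
  ring

theorem gaussianPDFReal_shift_le (m : ℝ) {v : ℝ≥0} (hv : v ≠ 0) {a e w : ℝ}
    (he : |e| = a) (hew : e * w = a * |w|) :
    gaussianPDFReal m v (w + e) ≤
      Real.exp (a * |m| / v) * (Real.exp (-(a / v) * |w|) * gaussianPDFReal m v w) := by
  rw [gaussianPDFReal_add_eq_exp_mul m hv (by rw [← he, sq_abs]) hew]
  have ha : 0 ≤ a := he ▸ abs_nonneg e
  have hem : e * m ≤ a * |m| := by rw [← he, ← abs_mul]; exact le_abs_self _
  have := gaussianPDFReal_nonneg m v w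
  gcongr
  have h₁ : e * m / v ≤ a * |m| / v := by gcongr
  have h₂ : 0 ≤ a ^ 2 / (2 * v) := by positivity
  linarith

theorem le_gaussianPDFReal_shift (m : ℝ) {v : ℝ≥0} (hv : v ≠ 0) {a e w : ℝ}
    (he : |e| = a) (hew : e * w = a * |w|) :
    Real.exp (-(a * |m| / v) - a ^ 2 / (2 * v)) *
      (Real.exp (-(a / v) * |w|) * gaussianPDFReal m v w) ≤ gaussianPDFReal m v (w + e) := by
  rw [gaussianPDFReal_add_eq_exp_mul m hv (by rw [← he, sq_abs]) hew]
  have hem : -(a * |m|) ≤ e * m := by rw [← he, ← abs_mul]; exact neg_abs_le _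
  have := gaussianPDFReal_nonneg m v w
  gcongr
  rw [← neg_div]
  gcongr

theorem lintegral_gaussianReal (m : ℝ) {v : ℝ≥0} (hv : v ≠ 0) {f : ℝ → ℝ≥0∞}
    (hf : Measurable f) :
    ∫⁻ x, f x ∂gaussianReal m v = ∫⁻ x, gaussianPDF m v x * f x := by
  rw [gaussianReal_of_var_ne_zero m hv,
    lintegral_withDensity_eq_lintegral_mul _ (measurable_gaussianPDF m v) hf]
  rfl

/-- `∫ F(|x|)ⁿ e^{-s|x|} dγ(x)`, where `F = absCdf γ`. -/
def expMoment (γ : Measure ℝ) (n : ℕ) (s : ℝ) : ℝ≥0∞ :=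
  ∫⁻ x, absCdf γ |x| ^ n * ENNReal.ofReal (Real.exp (-s * |x|)) ∂γ

theorem lintegral_absCdf_sub_pow (m : ℝ) {v : ℝ≥0} (hv : v ≠ 0) (n : ℕ) {a : ℝ}
    (ha : 0 ≤ a) :
    ∫⁻ x, absCdf (gaussianReal m v) (|x| - a) ^ (n + 1) ∂gaussianReal m v =
      ∫⁻ w, absCdf (gaussianReal m v) |w| ^ (n + 1) *
        ENNReal.ofReal (gaussianPDFReal m v (w + if 0 < w then a else -a)) := by
  have hφ := (measurable_absCdf (gaussianReal m v)).pow_const (n + 1)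
  have h := lintegral_abs_sub_mul (φ := fun r => absCdf (gaussianReal m v) r ^ (n + 1))
    (gaussianPDF m v) (fun r hr => by simp [absCdf_of_nonpos _ hr]) ha
  rw [lintegral_gaussianReal m hv (by exact hφ.comp (measurable_norm.sub_const a))]
  simp only [mul_comm (gaussianPDF m v _)]
  rw [h]
  refine lintegral_congr fun w => ?_
  split_ifs <;> simp [gaussianPDF, sub_eq_add_neg]

theorem ofReal_mul_expMoment_gaussianReal (m : ℝ) {v : ℝ≥0} (hv : v ≠ 0) (n : ℕ) (s : ℝ)
    (c : ℝ) (hc : 0 ≤ c) :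
    ENNReal.ofReal c * expMoment (gaussianReal m v) n s =
      ∫⁻ w, absCdf (gaussianReal m v) |w| ^ n *
        ENNReal.ofReal (c * (Real.exp (-s * |w|) * gaussianPDFReal m v w)) := by
  have hm : Measurable fun w : ℝ => absCdf (gaussianReal m v) |w| ^ n *
      ENNReal.ofReal (Real.exp (-s * |w|)) :=
    (((measurable_absCdf _).comp measurable_norm).pow_const n).mul (by fun_prop)
  rw [expMoment, lintegral_gaussianReal m hv hm,
    ← lintegral_const_mul _ (by exact (measurable_gaussianPDF m v).mul hm)]
  refine lintegral_congr fun w => ?_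
  rw [ENNReal.ofReal_mul hc, ENNReal.ofReal_mul (Real.exp_pos _).le, gaussianPDF]
  ring

theorem shift_sign {a : ℝ} (ha : 0 ≤ a) (w : ℝ) :
    |if 0 < w then a else -a| = a ∧ (if 0 < w then a else -a) * w = a * |w| := by
  split_ifs with h
  · simp [abs_of_nonneg ha, abs_of_pos h]
  · simp [abs_of_nonneg ha, abs_of_nonpos (not_lt.1 h)]

theorem lintegral_absCdf_sub_pow_le (m : ℝ) {v : ℝ≥0} (hv : v ≠ 0) (n : ℕ) {a : ℝ}
    (ha : 0 ≤ a) :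
    ∫⁻ x, absCdf (gaussianReal m v) (|x| - a) ^ (n + 1) ∂gaussianReal m v ≤
      ENNReal.ofReal (Real.exp (a * |m| / v)) *
        expMoment (gaussianReal m v) (n + 1) (a / v) := by
  rw [lintegral_absCdf_sub_pow m hv n ha,
    ofReal_mul_expMoment_gaussianReal m hv _ _ _ (Real.exp_pos _).le]
  gcongr with w
  exact gaussianPDFReal_shift_le m hv (shift_sign ha w).1 (shift_sign ha w).2

theorem le_lintegral_absCdf_sub_pow (m : ℝ) {v : ℝ≥0} (hv : v ≠ 0) (n : ℕ) {a : ℝ}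
    (ha : 0 ≤ a) :
    ENNReal.ofReal (Real.exp (-(a * |m| / v) - a ^ 2 / (2 * v))) *
        expMoment (gaussianReal m v) (n + 1) (a / v) ≤
      ∫⁻ x, absCdf (gaussianReal m v) (|x| - a) ^ (n + 1) ∂gaussianReal m v := by
  rw [lintegral_absCdf_sub_pow m hv n ha,
    ofReal_mul_expMoment_gaussianReal m hv _ _ _ (Real.exp_pos _).le]
  gcongr with w
  exact le_gaussianPDFReal_shift m hv (shift_sign ha w).1 (shift_sign ha w).2

/-! ### Bounds on the exponential moment of the maximum -/

theorem mul_expMoment_le (γ : Measure ℝ) [IsProbabilityMeasure γ] (n : ℕ) {s : ℝ} (hs : 0 ≤ s)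
    (r : ℝ) :
    (n + 1) * expMoment γ n s ≤
      (n + 1) * absCdf γ r ^ n + ENNReal.ofReal (Real.exp (-s * r)) := by
  have hpt : ∀ x, absCdf γ |x| ^ n * ENNReal.ofReal (Real.exp (-s * |x|)) ≤
      absCdf γ r ^ n + ENNReal.ofReal (Real.exp (-s * r)) * absCdf γ |x| ^ n := by
    intro x
    rcases le_total |x| r with h | h
    · refine le_add_right ?_
      have h1 : ENNReal.ofReal (Real.exp (-s * |x|)) ≤ 1 := by
        rw [ENNReal.ofReal_le_one, Real.exp_le_one_iff]
        nlinarith [abs_nonneg x]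
      calc _ ≤ absCdf γ r ^ n * 1 := by gcongr; exact absCdf_mono γ h
        _ = _ := mul_one _
    · refine le_add_left ?_
      rw [mul_comm]
      gcongr ENNReal.ofReal (Real.exp ?_) * _
      nlinarith
  have hm : Measurable fun x : ℝ => absCdf γ |x| ^ n :=
    ((measurable_absCdf γ).comp measurable_norm).pow_const n
  calc (n + 1) * expMoment γ n s
      ≤ (n + 1) * (absCdf γ r ^ n +
          ENNReal.ofReal (Real.exp (-s * r)) * ∫⁻ x, absCdf γ |x| ^ n ∂γ) := by
        gcongr
        refine (lintegral_mono hpt).trans ?_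
        rw [lintegral_add_left measurable_const, lintegral_const_mul _ hm]
        simp
    _ = (n + 1) * absCdf γ r ^ n + ENNReal.ofReal (Real.exp (-s * r)) *
          ((n + 1) * ∫⁻ x, absCdf γ |x| ^ n ∂γ) := by ring
    _ ≤ _ := by
        gcongr
        exact mul_le_of_le_one_right' (mul_lintegral_absCdf_pow_le_one γ n)

theorem le_mul_expMoment_add (γ : Measure ℝ) [IsProbabilityMeasure γ] [NullSingletonClass γ]
    (n : ℕ) {s : ℝ} (hs : 0 ≤ s) {r : ℝ} (hr : 0 ≤ r) :
    ENNReal.ofReal (Real.exp (-s * r)) ≤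
      (n + 1) * expMoment γ n s + (n + 1) * γ {x | r < |x|} := by
  have hset : MeasurableSet {x : ℝ | r < |x|} := measurableSet_lt (by fun_prop) (by fun_prop)
  have hpt : ∀ x, ENNReal.ofReal (Real.exp (-s * r)) * absCdf γ |x| ^ n ≤
      absCdf γ |x| ^ n * ENNReal.ofReal (Real.exp (-s * |x|)) +
        {x : ℝ | r < |x|}.indicator 1 x := by
    intro x
    rcases le_or_gt |x| r with h | h
    · refine le_add_right ?_
      rw [mul_comm]
      gcongr _ * ENNReal.ofReal (Real.exp ?_)
      nlinarith
    · refine le_add_left ?_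
      have h1 : ENNReal.ofReal (Real.exp (-s * r)) ≤ 1 := by
        rw [ENNReal.ofReal_le_one, Real.exp_le_one_iff]
        nlinarith
      simpa [Set.indicator, h] using
        mul_le_one' h1 (pow_le_one₀ zero_le (absCdf_le_one γ |x|))
  have hm : Measurable fun x : ℝ => absCdf γ |x| ^ n :=
    ((measurable_absCdf γ).comp measurable_norm).pow_const n
  calc ENNReal.ofReal (Real.exp (-s * r))
      ≤ ENNReal.ofReal (Real.exp (-s * r)) * ((n + 1) * ∫⁻ x, absCdf γ |x| ^ n ∂γ) :=
        le_mul_of_one_le_right' (one_le_mul_lintegral_absCdf_pow γ n)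
    _ = (n + 1) * ∫⁻ x, ENNReal.ofReal (Real.exp (-s * r)) * absCdf γ |x| ^ n ∂γ := by
        rw [lintegral_const_mul _ hm]; ring
    _ ≤ (n + 1) * (expMoment γ n s + γ {x | r < |x|}) := by
        gcongr
        refine (lintegral_mono hpt).trans ?_
        rw [lintegral_add_right _ (measurable_one.indicator hset), lintegral_indicator_one hset]
        rfl
    _ = _ := by ring

/-! ### Gaussian tails -/

theorem gaussianReal_tail_le (m : ℝ) (v : ℝ≥0) {l : ℝ} (hl : 0 ≤ l) (r : ℝ) :
    (gaussianReal m v).real {x | r < |x|} ≤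
      2 * Real.exp (-l * r + |m| * l + v * l ^ 2 / 2) := by
  have hsub : {x : ℝ | r < |x|} ⊆ {x | r ≤ id x} ∪ {x | id x ≤ -r} := by
    intro x (hx : r < |x|)
    rcases lt_abs.1 hx with h | h
    · exact Or.inl h.le
    · exact Or.inr (show x ≤ -r by linarith)
  have hexp_int : ∀ s : ℝ, Integrable (fun x => Real.exp (s * id x)) (gaussianReal m v) :=
    fun s => integrable_exp_mul_gaussianReal s
  have hup := measure_ge_le_exp_mul_mgf (μ := gaussianReal m v) (X := id) r hl (hexp_int l)
  have hlo := measure_le_le_exp_mul_mgf (μ := gaussianReal m v) (X := id) (-r)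
    (neg_nonpos.2 hl) (hexp_int (-l))
  rw [mgf_id_gaussianReal, ← Real.exp_add] at hup hlo
  have h₁ : Real.exp (-l * r + (m * l + v * l ^ 2 / 2)) ≤
      Real.exp (-l * r + |m| * l + v * l ^ 2 / 2) := by
    refine Real.exp_le_exp.2 ?_
    nlinarith [le_abs_self m]
  have h₂ : Real.exp (- -l * -r + (m * -l + v * (-l) ^ 2 / 2)) ≤
      Real.exp (-l * r + |m| * l + v * l ^ 2 / 2) := by
    refine Real.exp_le_exp.2 ?_
    nlinarith [neg_abs_le m]
  have := (measureReal_mono hsub).trans (measureReal_union_le (μ := gaussianReal m v) _ _)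
  linarith

theorem absCdf_gaussianReal_le (m : ℝ) {v : ℝ≥0} (hv : v ≠ 0) {r : ℝ} (hr : 0 ≤ r) :
    absCdf (gaussianReal m v) r ≤ ENNReal.ofReal (Real.exp
      (-((√(2 * π * v))⁻¹ * Real.exp (-(r + 1 + |m|) ^ 2 / (2 * v))))) := by
  set q : ℝ := (√(2 * π * v))⁻¹ * Real.exp (-(r + 1 + |m|) ^ 2 / (2 * v)) with hq
  have hmass : ENNReal.ofReal q ≤ gaussianReal m v (Set.Icc r (r + 1)) := by
    rw [gaussianReal_apply m hv]
    calc ENNReal.ofReal q = ∫⁻ _ in Set.Icc r (r + 1), ENNReal.ofReal q := by simp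
      _ ≤ _ := by
        refine setLIntegral_mono (measurable_gaussianPDF m v) fun x hx => ?_
        rw [gaussianPDF, gaussianPDFReal]
        gcongr ENNReal.ofReal ?_
        have h : |x - m| ≤ |(r + 1 + |m|)| := by
          rw [abs_of_nonneg (show 0 ≤ r + 1 + |m| by positivity), abs_le]
          constructor <;> linarith [hx.1, hx.2, le_abs_self m, neg_abs_le m]
        have := sq_le_sq.2 h
        gcongr
  have hcompl : absCdf (gaussianReal m v) r ≤ 1 - ENNReal.ofReal q := by
    refine le_trans ?_ (tsub_le_tsub_left hmass 1)
    rw [← prob_compl_eq_one_sub measurableSet_Icc]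
    refine measure_mono fun x (hx : |x| < r) hx' => ?_
    linarith [hx'.1, le_abs_self x]
  refine hcompl.trans ?_
  rw [← ENNReal.ofReal_one, ← ENNReal.ofReal_sub _ (by positivity)]
  exact ENNReal.ofReal_le_ofReal (by linarith [Real.add_one_le_exp (-q)])

/-! ### Bounds on the gap probability when `N = exp (u⁴ / (2v))` -/

theorem le_gap_prob {m t : ℝ} {v : ℝ≥0} (hv : v ≠ 0) (ht : 0 ≤ t) {n : ℕ} {u : ℝ}
    (hu : 0 < u) (hN : (n : ℝ) + 2 = Real.exp (u ^ 4 / (2 * v))) :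
    ENNReal.ofReal (Real.exp (-(t * |m| / u ^ 2) - t ^ 2 * v / (2 * u ^ 4)) *
      (Real.exp (-(t + t / u)) - 2 * Real.exp (u ^ 2 * ((|m| - u) / v)))) ≤
    (n + 2) * ∫⁻ x, absCdf (gaussianReal m v) (|x| - t * v / u ^ 2) ^ (n + 1)
      ∂gaussianReal m v := by
  have hv' : (v : ℝ) ≠ 0 := by exact_mod_cast hv
  have := nullSingletonClass_gaussianReal (μ := m) hv
  have hcast : (((n + 1 : ℕ) : ℝ≥0∞) + 1) = n + 2 := by push_cast; ring
  have hs : t * v / u ^ 2 / v = t / u ^ 2 := by field_simp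
  have htail : ((n : ℝ≥0∞) + 2) * gaussianReal m v {x | u ^ 2 + u < |x|} ≤
      ENNReal.ofReal (2 * Real.exp (u ^ 2 * ((|m| - u) / v))) := by
    have h := gaussianReal_tail_le m v (l := u ^ 2 / v) (by positivity) (u ^ 2 + u)
    have hn : ((n : ℝ≥0∞) + 2) = ENNReal.ofReal (n + 2) := by
      rw [ENNReal.ofReal_add (by positivity) (by norm_num)]; simp
    rw [hn, ← ofReal_measureReal, ← ENNReal.ofReal_mul (by positivity)]
    refine ENNReal.ofReal_le_ofReal ?_
    calc _ ≤ ((n : ℝ) + 2) * (2 * Real.exp (-(u ^ 2 / v) * (u ^ 2 + u) + |m| * (u ^ 2 / v) +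
          v * (u ^ 2 / v) ^ 2 / 2)) := by gcongr
      _ = _ := by
        rw [hN, mul_left_comm, ← Real.exp_add]
        congr 2
        field_simp
        ring
  have hmom := le_mul_expMoment_add (gaussianReal m v) (n + 1) (s := t / u ^ 2)
    (by positivity) (r := u ^ 2 + u) (by positivity)
  rw [hcast] at hmom
  have hsr : -(t / u ^ 2) * (u ^ 2 + u) = -(t + t / u) := by field_simp
  rw [hsr] at hmom
  have hshift := le_lintegral_absCdf_sub_pow m hv n (a := t * v / u ^ 2) (by positivity)
  rw [hs] at hshift
  have hE : -(t * v / u ^ 2 * |m| / v) - (t * v / u ^ 2) ^ 2 / (2 * v) =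
      -(t * |m| / u ^ 2) - t ^ 2 * v / (2 * u ^ 4) := by field_simp
  rw [hE] at hshift
  rw [ENNReal.ofReal_mul (Real.exp_pos _).le, ENNReal.ofReal_sub _ (by positivity)]
  calc _ ≤ ENNReal.ofReal (Real.exp (-(t * |m| / u ^ 2) - t ^ 2 * v / (2 * u ^ 4))) *
        ((n + 2) * expMoment (gaussianReal m v) (n + 1) (t / u ^ 2)) := by
        gcongr
        rw [tsub_le_iff_right]
        exact hmom.trans (by gcongr)
    _ = (n + 2) * (ENNReal.ofReal (Real.exp (-(t * |m| / u ^ 2) - t ^ 2 * v / (2 * u ^ 4))) *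
        expMoment (gaussianReal m v) (n + 1) (t / u ^ 2)) := by ring
    _ ≤ _ := by gcongr

theorem mul_absCdf_pow_le {m : ℝ} {v : ℝ≥0} (hv : v ≠ 0) {n : ℕ} {u : ℝ}
    (hu : 2 * (1 + |m|) ≤ u) (hN : (n : ℝ) + 2 = Real.exp (u ^ 4 / (2 * v))) :
    ((n : ℝ≥0∞) + 2) * absCdf (gaussianReal m v) (u ^ 2 - u) ^ (n + 1) ≤
      ENNReal.ofReal (Real.exp
        (u ^ 4 * (1 / (2 * v) - (√(2 * π * v))⁻¹ / (64 * v ^ 2) * u ^ 2))) := by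
  have hv' : (0 : ℝ) < v := by exact_mod_cast pos_iff_ne_zero.2 hv
  have hm := abs_nonneg m
  have hc : 0 < (√(2 * π * v))⁻¹ := by positivity
  set c := (√(2 * π * v))⁻¹
  have hF := absCdf_gaussianReal_le m hv (r := u ^ 2 - u) (by nlinarith)
  set q := c * Real.exp (-(u ^ 2 - u + 1 + |m|) ^ 2 / (2 * v)) with hq
  have hsq : (u ^ 2 - u + 1 + |m|) ^ 2 ≤ u ^ 4 - u ^ 3 / 2 := by
    calc (u ^ 2 - u + 1 + |m|) ^ 2 ≤ (u ^ 2 - u / 2) ^ 2 := by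
          apply pow_le_pow_left₀ <;> nlinarith
      _ = u ^ 4 - u ^ 3 / 2 - u ^ 2 * (u / 2 - 1 / 4) := by ring
      _ ≤ _ := by
          have : 0 ≤ u ^ 2 * (u / 2 - 1 / 4) := mul_nonneg (sq_nonneg u) (by linarith)
          linarith
  have hNq : u ^ 6 * (c / (64 * v ^ 2)) ≤ (n + 1) * q := by
    have hy : 0 ≤ u ^ 3 / (4 * v) := by
      have : 0 ≤ u := by linarith
      positivity
    have h1 : (u ^ 3 / (4 * v)) ^ 2 / 2 ≤ Real.exp (u ^ 3 / (4 * v)) := by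
      linarith [Real.quadratic_le_exp_of_nonneg hy]
    have h2 : Real.exp (u ^ 3 / (4 * v)) ≤
        ((n : ℝ) + 2) * Real.exp (-(u ^ 2 - u + 1 + |m|) ^ 2 / (2 * v)) := by
      rw [hN, ← Real.exp_add, Real.exp_le_exp, ← add_div]
      calc u ^ 3 / (4 * v) = (u ^ 4 - (u ^ 4 - u ^ 3 / 2)) / (2 * v) := by field_simp; ring
        _ ≤ _ := by
          gcongr
          linarith
    have h3 : ((n : ℝ) + 2) * q ≤ 2 * ((n + 1) * q) := by
      have : 0 < q := by positivity
      have : 0 ≤ (n : ℝ) * q := by positivity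
      linarith
    have h4 : c * ((u ^ 3 / (4 * v)) ^ 2 / 2) ≤ ((n : ℝ) + 2) * q := by
      rw [hq, mul_left_comm]
      gcongr
      exact h1.trans h2
    have h5 : c * ((u ^ 3 / (4 * v)) ^ 2 / 2) = 2 * (u ^ 6 * (c / (64 * v ^ 2))) := by
      field_simp
      ring
    linarith
  have hn : ((n : ℝ≥0∞) + 2) = ENNReal.ofReal (n + 2) := by
    rw [ENNReal.ofReal_add (by positivity) (by norm_num)]; simp
  calc _ ≤ ENNReal.ofReal (n + 2) * ENNReal.ofReal (Real.exp (-q)) ^ (n + 1) := by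
        rw [hn]
        gcongr
    _ = ENNReal.ofReal (Real.exp (u ^ 4 / (2 * v) + (n + 1) * -q)) := by
        rw [← ENNReal.ofReal_pow (Real.exp_pos _).le, ← ENNReal.ofReal_mul (by positivity),
          ← Real.exp_nat_mul, hN, ← Real.exp_add]
        push_cast
        rfl
    _ ≤ _ := by
        gcongr
        have : u ^ 4 * (1 / (2 * v) - c / (64 * v ^ 2) * u ^ 2) =
          u ^ 4 / (2 * v) - u ^ 6 * (c / (64 * v ^ 2)) := by ring
        linarith

theorem gap_prob_le {m t : ℝ} {v : ℝ≥0} (hv : v ≠ 0) (ht : 0 ≤ t) {n : ℕ} {u : ℝ}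
    (hu : 2 * (1 + |m|) ≤ u) (hN : (n : ℝ) + 2 = Real.exp (u ^ 4 / (2 * v))) :
    (n + 2) * ∫⁻ x, absCdf (gaussianReal m v) (|x| - t * v / u ^ 2) ^ (n + 1)
      ∂gaussianReal m v ≤
    ENNReal.ofReal (Real.exp (t * |m| / u ^ 2) *
      (Real.exp (u ^ 4 * (1 / (2 * v) - (√(2 * π * v))⁻¹ / (64 * v ^ 2) * u ^ 2)) +
        Real.exp (-(t - t / u)))) := by
  have hv' : (v : ℝ) ≠ 0 := by exact_mod_cast hv
  have hu₀ : 0 < u := by linarith [abs_nonneg m]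
  have hcast : (((n + 1 : ℕ) : ℝ≥0∞) + 1) = n + 2 := by push_cast; ring
  have hs : t * v / u ^ 2 / v = t / u ^ 2 := by field_simp
  have hmom := mul_expMoment_le (gaussianReal m v) (n + 1) (s := t / u ^ 2)
    (by positivity) (u ^ 2 - u)
  rw [hcast] at hmom
  have hsr : -(t / u ^ 2) * (u ^ 2 - u) = -(t - t / u) := by field_simp
  rw [hsr] at hmom
  have hshift := lintegral_absCdf_sub_pow_le m hv n (a := t * v / u ^ 2) (by positivity)
  have hE : t * v / u ^ 2 * |m| / v = t * |m| / u ^ 2 := by field_simp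
  rw [hs, hE] at hshift
  rw [ENNReal.ofReal_mul (Real.exp_pos _).le,
    ENNReal.ofReal_add (Real.exp_pos _).le (Real.exp_pos _).le]
  calc _ ≤ (n + 2) * (ENNReal.ofReal (Real.exp (t * |m| / u ^ 2)) *
        expMoment (gaussianReal m v) (n + 1) (t / u ^ 2)) := by gcongr
    _ = ENNReal.ofReal (Real.exp (t * |m| / u ^ 2)) *
        ((n + 2) * expMoment (gaussianReal m v) (n + 1) (t / u ^ 2)) := by ring
    _ ≤ _ := by
        gcongr
        exact hmom.trans (by gcongr; exact mul_absCdf_pow_le hv hu hN)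

theorem tendsto_lower_bound (m t : ℝ) {v : ℝ≥0} (hv : v ≠ 0) :
    Tendsto (fun u : ℝ => Real.exp (-(t * |m| / u ^ 2) - t ^ 2 * v / (2 * u ^ 4)) *
      (Real.exp (-(t + t / u)) - 2 * Real.exp (u ^ 2 * ((|m| - u) / v)))) atTop
      (nhds (Real.exp (-t))) := by
  have hv' : (0 : ℝ) < v := by exact_mod_cast pos_iff_ne_zero.2 hv
  have h₁ : Tendsto (fun u : ℝ => t * |m| / u ^ 2) atTop (nhds 0) :=
    tendsto_const_nhds.div_atTop (tendsto_pow_atTop two_ne_zero)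
  have h₂ : Tendsto (fun u : ℝ => t ^ 2 * v / (2 * u ^ 4)) atTop (nhds 0) :=
    tendsto_const_nhds.div_atTop
      ((tendsto_pow_atTop (by norm_num)).const_mul_atTop two_pos)
  have h₃ : Tendsto (fun u : ℝ => t / u) atTop (nhds 0) :=
    tendsto_const_nhds.div_atTop tendsto_id
  have h₄ : Tendsto (fun u : ℝ => u ^ 2 * ((|m| - u) / v)) atTop atBot := by
    refine (tendsto_pow_atTop two_ne_zero).atTop_mul_atBot₀ ?_
    refine Tendsto.atBot_div_const hv' ?_
    exact tendsto_atBot_add_const_left _ _ tendsto_neg_atTop_atBot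
  have h := ((h₁.neg.sub h₂).rexp).mul
    (((tendsto_const_nhds (x := t)).add h₃).neg.rexp.sub
      ((Real.tendsto_exp_atBot.comp h₄).const_mul 2))
  simpa using h

theorem tendsto_upper_bound (m t : ℝ) {v : ℝ≥0} (hv : v ≠ 0) :
    Tendsto (fun u : ℝ => Real.exp (t * |m| / u ^ 2) *
      (Real.exp (u ^ 4 * (1 / (2 * v) - (√(2 * π * v))⁻¹ / (64 * v ^ 2) * u ^ 2)) +
        Real.exp (-(t - t / u)))) atTop (nhds (Real.exp (-t))) := by
  have hv' : (0 : ℝ) < v := by exact_mod_cast pos_iff_ne_zero.2 hv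
  have h₁ : Tendsto (fun u : ℝ => t * |m| / u ^ 2) atTop (nhds 0) :=
    tendsto_const_nhds.div_atTop (tendsto_pow_atTop two_ne_zero)
  have h₂ : Tendsto (fun u : ℝ => t / u) atTop (nhds 0) :=
    tendsto_const_nhds.div_atTop tendsto_id
  have h₃ : Tendsto (fun u : ℝ =>
      u ^ 4 * (1 / (2 * v) - (√(2 * π * v))⁻¹ / (64 * v ^ 2) * u ^ 2)) atTop atBot := by
    refine (tendsto_pow_atTop (by norm_num)).atTop_mul_atBot₀ ?_
    refine tendsto_atBot_add_const_left _ _ (tendsto_neg_atTop_atBot.comp ?_)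
    exact (tendsto_pow_atTop two_ne_zero).const_mul_atTop (by positivity)
  have h := h₁.rexp.mul ((Real.tendsto_exp_atBot.comp h₃).add
    ((tendsto_const_nhds (x := t)).sub h₂).neg.rexp)
  simpa using h

/-- If `A ∈ ℝ^N` has i.i.d. entries distributed as `N(μ₀, σ²)` with `σ > 0`,
then for every `t > 0`, `lim_{N→∞} ℙ(δ(A) > tσ/√(2 ln N)) = e^{−t}`. -/
theorem gap_limit_gaussian
    (μ₀ : ℝ) (σ : ℝ≥0) (hσ : 0 < σ)
    (Ω : Type) [MeasurableSpace Ω] (μ : Measure Ω) [IsProbabilityMeasure μ]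
    (A : (N : ℕ) → Ω → Fin N → ℝ)
    (hmeas : ∀ N i, Measurable fun ω => A N ω i)
    (hindep : ∀ N, iIndepFun (fun i ω => A N ω i) μ)
    (hlaw : ∀ N i, Measure.map (fun ω => A N ω i) μ = gaussianReal μ₀ (σ ^ 2))
    (t : ℝ) (ht : 0 < t) :
    Tendsto
      (fun N : ℕ => (μ {ω | t * σ / Real.sqrt (2 * Real.log N) < gap (A N ω)}).toReal)
      atTop (nhds (Real.exp (-t))) := by
  have hσ' : (0 : ℝ) < σ := by exact_mod_cast hσ
  have hv : σ ^ 2 ≠ 0 := (pow_pos hσ 2).ne'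
  rw [← tendsto_add_atTop_iff_nat 2]
  set u : ℕ → ℝ := fun n => √(σ * √(2 * Real.log ((n + 2 : ℕ) : ℝ))) with hu_def
  have hu : Tendsto u atTop atTop := by
    refine tendsto_sqrt_atTop.comp (Tendsto.const_mul_atTop hσ' (tendsto_sqrt_atTop.comp
      (Tendsto.const_mul_atTop two_pos (Real.tendsto_log_atTop.comp ?_))))
    exact tendsto_natCast_atTop_atTop.comp (tendsto_add_atTop_nat 2)
  have hu2 : ∀ n, u n ^ 2 = σ * √(2 * Real.log ((n + 2 : ℕ) : ℝ)) := fun n =>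
    Real.sq_sqrt (by positivity)
  have hlog : ∀ n : ℕ, 0 < Real.log ((n + 2 : ℕ) : ℝ) := fun n =>
    Real.log_pos (by exact_mod_cast (by omega : 1 < n + 2))
  have hN : ∀ n : ℕ, (n : ℝ) + 2 = Real.exp (u n ^ 4 / (2 * (σ ^ 2 : ℝ≥0))) := by
    intro n
    have h4 : u n ^ 4 = σ ^ 2 * (2 * Real.log ((n + 2 : ℕ) : ℝ)) := by
      rw [show u n ^ 4 = (u n ^ 2) ^ 2 by ring, hu2, mul_pow,
        Real.sq_sqrt (by linarith [hlog n])]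
    have hdiv : u n ^ 4 / (2 * (σ ^ 2 : ℝ≥0)) = Real.log ((n + 2 : ℕ) : ℝ) := by
      rw [h4]
      push_cast
      field_simp
    rw [hdiv, Real.exp_log (by positivity)]
    push_cast
    rfl
  have hprob : ∀ n : ℕ, μ {ω | t * σ / √(2 * Real.log ((n + 2 : ℕ) : ℝ)) < gap (A (n + 2) ω)} =
      (n + 2) * ∫⁻ x, absCdf (gaussianReal μ₀ (σ ^ 2))
        (|x| - t * (σ ^ 2 : ℝ≥0) / u n ^ 2) ^ (n + 1) ∂gaussianReal μ₀ (σ ^ 2) := by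
    intro n
    rw [measure_lt_gap (hmeas _) (hindep _) (hlaw _) (by positivity)]
    have hthr : t * (σ ^ 2 : ℝ≥0) / u n ^ 2 = t * σ / √(2 * Real.log ((n + 2 : ℕ) : ℝ)) := by
      rw [hu2]
      push_cast
      field_simp
    rw [hthr]
  refine tendsto_of_tendsto_of_tendsto_of_le_of_le' ((tendsto_lower_bound μ₀ t hv).comp hu)
    ((tendsto_upper_bound μ₀ t hv).comp hu) ?_ ?_
  · filter_upwards [hu.eventually_gt_atTop 0] with n hn
    rw [← ENNReal.ofReal_le_iff_le_toReal (measure_ne_top _ _), hprob]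
    exact le_gap_prob hv ht.le hn (hN n)
  · filter_upwards [hu.eventually_ge_atTop (2 * (1 + |μ₀|))] with n hn
    refine ENNReal.toReal_le_of_le_ofReal (by dsimp only [Function.comp_apply]; positivity) ?_
    rw [hprob]
    exact gap_prob_le hv ht.le hn (hN n)
end
end
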